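/- arXiv:1003.3723 — 2 statements merged into one kernel-verified Lean document; each statement's English description precedes it below -/
import Mathlib

section
/- For all positive integers n, m and all reals L > 0 and δ > 0, there exist a positive integer N and a real L' ≥ 1, depending only on n, m, L and δ, such that for every L-Lipschitz map f : [0,1]^n → ℝ^m there exist sets Z, K_1, …, K_N ⊆ [0,1]^n with Z ∪ K_1 ∪ ⋯ ∪ K_N = [0,1]^n, such that the Hausdorff n-content of f(Z) is less than δ, and f is biLipschitz with constant L' on each K_i. -/
open MeasureTheory Metric Set Filter
open scoped ENNReal NNReal

noncomputable section

/-- The closed unit cube `[0,1]^n` in `ℝ^n` with the Euclidean metric. -/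
def unitCube (n : ℕ) : Set (EuclideanSpace ℝ (Fin n)) :=
  {x | ∀ i, x i ∈ Set.Icc (0:ℝ) 1}

/-- Hausdorff `d`-content: the infimum over countable covers `{U i}` of `S`
of `∑ i, (diam (U i))^d`. -/
def hContent {X : Type*} [PseudoEMetricSpace X] (d : ℝ) (S : Set X) : ℝ≥0∞ :=
  ⨅ (U : ℕ → Set X) (_ : S ⊆ ⋃ i, U i), ∑' i, EMetric.diam (U i) ^ d

/-- `F` is biLipschitz with constant `L` on `S`. -/
def BiLipschitzWithOn {X Y : Type*} [PseudoMetricSpace X] [PseudoMetricSpace Y]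
    (L : ℝ) (F : X → Y) (S : Set X) : Prop :=
  ∀ x ∈ S, ∀ y ∈ S, L⁻¹ * dist x y ≤ dist (F x) (F y) ∧ dist (F x) (F y) ≤ L * dist x y

/-- `F` is biLipschitz on `S`: for some `L ≥ 1`,
`L⁻¹ · dist x y ≤ dist (F x) (F y) ≤ L · dist x y` on `S`. -/
def BiLipschitzOn {X Y : Type*} [PseudoMetricSpace X] [PseudoMetricSpace Y]
    (F : X → Y) (S : Set X) : Prop :=
  ∃ L : ℝ, 1 ≤ L ∧ BiLipschitzWithOn L F S


/-! ### Hausdorff content as an outer measure -/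

section Content

variable {X : Type*} [PseudoEMetricSpace X]

/-- The Hausdorff content, bundled as an outer measure. -/
def hContentOuter (X : Type*) [PseudoEMetricSpace X] (d : ℝ) (hd : 0 < d) : OuterMeasure X :=
  OuterMeasure.ofFunction (fun U => Metric.ediam U ^ d) (by simp [hd])

theorem hContent_eq_outer (d : ℝ) (hd : 0 < d) (S : Set X) :
    hContent d S = hContentOuter X d hd S := rfl

theorem hContent_mono {d : ℝ} (hd : 0 < d) {S T : Set X} (h : S ⊆ T) :
    hContent d S ≤ hContent d T := by
  simp only [hContent_eq_outer d hd]
  exact measure_mono h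

theorem hContent_le_diam {d : ℝ} (hd : 0 < d) (S : Set X) :
    hContent d S ≤ Metric.ediam S ^ d := by
  simp only [hContent_eq_outer d hd]
  exact OuterMeasure.ofFunction_le S

theorem hContent_iUnion_le {ι : Type*} [Countable ι] {d : ℝ} (hd : 0 < d) (S : ι → Set X) :
    hContent d (⋃ i, S i) ≤ ∑' i, hContent d (S i) := by
  simp only [hContent_eq_outer d hd]
  exact measure_iUnion_le S

theorem hContent_union_le {d : ℝ} (hd : 0 < d) (S T : Set X) :
    hContent d (S ∪ T) ≤ hContent d S + hContent d T := by
  simp only [hContent_eq_outer d hd]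
  exact measure_union_le S T

end Content

/-! ### Dyadic cubes -/

section Dyadic

variable {n : ℕ}

/-- The index of the half-open dyadic cube of side `2⁻ᵏ` that contains `x`. -/
def dyadicIndex (k : ℕ) (x : Fin n → ℝ) : Fin n → ℤ := fun i => ⌊(2:ℝ) ^ k * x i⌋

/-- The half-open dyadic cube of side `2⁻ᵏ` with index `j`. -/
def dyadicCube (k : ℕ) (j : Fin n → ℤ) : Set (Fin n → ℝ) := {x | dyadicIndex k x = j}

theorem mem_dyadicCube_index (k : ℕ) (x : Fin n → ℝ) : x ∈ dyadicCube k (dyadicIndex k x) := rfl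

theorem mem_dyadicCube_iff {k : ℕ} {j : Fin n → ℤ} {x : Fin n → ℝ} :
    x ∈ dyadicCube k j ↔ ∀ i, (j i : ℝ) ≤ 2 ^ k * x i ∧ 2 ^ k * x i < j i + 1 := by
  simp [dyadicCube, dyadicIndex, funext_iff, Int.floor_eq_iff]

theorem dyadicIndex_eq_of_succ {k : ℕ} {x y : Fin n → ℝ}
    (h : dyadicIndex (k + 1) x = dyadicIndex (k + 1) y) : dyadicIndex k x = dyadicIndex k y := by
  have hy := mem_dyadicCube_index k y
  have hx : x ∈ dyadicCube (k + 1) (dyadicIndex (k + 1) y) := h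
  have hy' := mem_dyadicCube_index (k + 1) y
  rw [mem_dyadicCube_iff] at hx hy hy'
  have : x ∈ dyadicCube k (dyadicIndex k y) := by
    rw [mem_dyadicCube_iff]
    intro i
    obtain ⟨h1, h2⟩ := hx i
    obtain ⟨h3, h4⟩ := hy i
    obtain ⟨h5, h6⟩ := hy' i
    set a := dyadicIndex k y i
    set b := dyadicIndex (k + 1) y i
    rw [pow_succ] at h1 h2 h5 h6
    have e1 : 2 * a < b + 1 := by
      have : ((2 * a : ℤ) : ℝ) < ((b + 1 : ℤ) : ℝ) := by push_cast; linarith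
      exact_mod_cast this
    have e2 : b < 2 * a + 2 := by
      have : ((b : ℤ) : ℝ) < ((2 * a + 2 : ℤ) : ℝ) := by push_cast; linarith
      exact_mod_cast this
    have e1' : ((2 * a : ℤ) : ℝ) ≤ b := by exact_mod_cast (by omega : 2 * a ≤ b)
    have e2' : ((b + 1 : ℤ) : ℝ) ≤ ((2 * a + 2 : ℤ) : ℝ) := by
      exact_mod_cast (by omega : b + 1 ≤ 2 * a + 2)
    push_cast at e1' e2'
    constructor <;> linarith
  exact this

theorem dyadicIndex_eq_of_le {i k : ℕ} (hik : i ≤ k) {x y : Fin n → ℝ}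
    (h : dyadicIndex k x = dyadicIndex k y) : dyadicIndex i x = dyadicIndex i y := by
  induction k, hik using Nat.le_induction with
  | base => exact h
  | succ k _ ih => exact ih (dyadicIndex_eq_of_succ h)

theorem dyadicCube_eq_pi (k : ℕ) (j : Fin n → ℤ) :
    dyadicCube k j = univ.pi fun i => Ico ((j i : ℝ) / 2 ^ k) ((j i + 1) / 2 ^ k) := by
  ext x
  have h2 : (0:ℝ) < 2 ^ k := by positivity
  simp only [mem_dyadicCube_iff, mem_univ_pi, mem_Ico, div_le_iff₀ h2, lt_div_iff₀ h2,
    mul_comm (x _)]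

theorem measurableSet_dyadicCube (k : ℕ) (j : Fin n → ℤ) : MeasurableSet (dyadicCube k j) := by
  rw [dyadicCube_eq_pi]
  exact MeasurableSet.univ_pi fun _ => measurableSet_Ico

theorem convex_dyadicCube (k : ℕ) (j : Fin n → ℤ) : Convex ℝ (dyadicCube k j) := by
  rw [dyadicCube_eq_pi]
  exact convex_pi fun _ _ => convex_Ico _ _

theorem volume_dyadicCube (k : ℕ) (j : Fin n → ℤ) :
    volume (dyadicCube k j) = ENNReal.ofReal ((1 / 2) ^ k) ^ n := by
  rw [dyadicCube_eq_pi, Real.volume_pi_Ico]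
  have : ∀ i, ((j i : ℝ) + 1) / 2 ^ k - j i / 2 ^ k = (1 / 2) ^ k := by
    intro i; rw [← sub_div]; simp
  simp [this]

theorem norm_sub_le_of_mem_dyadicCube {k : ℕ} {j : Fin n → ℤ} {x y : Fin n → ℝ}
    (hx : x ∈ dyadicCube k j) (hy : y ∈ dyadicCube k j) : ‖x - y‖ ≤ (1 / 2) ^ k := by
  rw [pi_norm_le_iff_of_nonneg (by positivity)]
  intro i
  have h2 : (0:ℝ) < 2 ^ k := by positivity
  rw [mem_dyadicCube_iff] at hx hy
  obtain ⟨a, b⟩ := hx i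
  obtain ⟨c, d⟩ := hy i
  rw [Real.norm_eq_abs, Pi.sub_apply, one_div, inv_pow, ← one_div, le_div_iff₀ h2,
    ← abs_of_pos h2, ← abs_mul, abs_le]
  constructor <;> linarith

theorem disjoint_dyadicCube {k : ℕ} {j j' : Fin n → ℤ} (h : j ≠ j') :
    Disjoint (dyadicCube k j) (dyadicCube k j') := by
  rw [Set.disjoint_left]
  intro x hx hx'
  exact h (hx.symm.trans hx')

end Dyadic

/-! ### Second differences and their energy -/

section Energy

variable {V E : Type*} [AddCommGroup V] [NormedAddCommGroup E]

/-- The second difference of `F` at `x` with increment `u`. -/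
def secondDiff (F : V → E) (u x : V) : E := F (x + (u + u)) - F (x + u) - (F (x + u) - F x)

end Energy

section Packing

variable {n : ℕ} {E : Type*} [NormedAddCommGroup E]
  {F : (Fin n → ℝ) → E} {L : ℝ}

theorem continuous_of_norm_sub_le (hF : ∀ x y, ‖F x - F y‖ ≤ L * ‖x - y‖) : Continuous F :=
  (LipschitzWith.of_dist_le_mul (K := L.toNNReal) fun x y => by
    rw [dist_eq_norm, dist_eq_norm]
    exact (hF x y).trans (by gcongr; exact Real.le_coe_toNNReal L)).continuous

theorem continuous_secondDiff (hF : Continuous F) (u : Fin n → ℝ) :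
    Continuous (secondDiff F u) := by
  unfold secondDiff; fun_prop

theorem norm_secondDiff_sub_le (hF : ∀ x y, ‖F x - F y‖ ≤ L * ‖x - y‖) (u u' x x' : Fin n → ℝ) :
    ‖secondDiff F u x - secondDiff F u' x'‖ ≤ 4 * L * (‖x - x'‖ + ‖u - u'‖) := by
  have hL : 0 ≤ L * ‖x - x'‖ := (norm_nonneg _).trans (hF x x')
  have hLu : 0 ≤ L * ‖u - u'‖ := (norm_nonneg _).trans (hF u u')
  have e : secondDiff F u x - secondDiff F u' x' =
      (F (x + (u + u)) - F (x' + (u' + u'))) - ((F (x + u) - F (x' + u'))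
        + (F (x + u) - F (x' + u'))) + (F x - F x') := by
    unfold secondDiff; abel
  have hL0 : 0 ≤ L ∨ ∀ z : Fin n → ℝ, ‖z‖ = 0 := by
    by_contra! h
    obtain ⟨h1, z, hz⟩ := h
    have := (norm_nonneg _).trans (hF z 0)
    rw [sub_zero] at this
    have h3 : 0 < ‖z‖ := lt_of_le_of_ne (norm_nonneg _) hz.symm
    nlinarith
  have key : ∀ a b c : Fin n → ℝ, ‖a‖ ≤ ‖b‖ + ‖c‖ → L * ‖a‖ ≤ L * ‖b‖ + L * ‖c‖ := by
    intro a b c h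
    rcases hL0 with h0 | h0
    · rw [← mul_add]; gcongr
    · simp [h0]
  have h1 : L * ‖x + u - (x' + u')‖ ≤ L * ‖x - x'‖ + L * ‖u - u'‖ :=
    key _ _ _ (by rw [add_sub_add_comm]; exact norm_add_le _ _)
  have h2 : L * ‖x + (u + u) - (x' + (u' + u'))‖ ≤ L * ‖x + u - (x' + u')‖ + L * ‖u - u'‖ :=
    key _ _ _ (by
      rw [← add_assoc, ← add_assoc x', add_sub_add_comm]; exact norm_add_le _ _)
  have b1 := hF (x + (u + u)) (x' + (u' + u'))
  have b2 := hF (x + u) (x' + u')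
  have b3 := hF x x'
  rw [e]
  calc _ ≤ ‖F (x + (u + u)) - F (x' + (u' + u'))‖ + (‖F (x + u) - F (x' + u')‖
        + ‖F (x + u) - F (x' + u')‖) + ‖F x - F x'‖ :=
        (norm_add_le _ _).trans (by
          gcongr; exact (norm_sub_le _ _).trans (by gcongr; exact norm_add_le _ _))
    _ ≤ _ := by linarith

/-- The squared `L²` norm of the first difference of `F` with increment `h`. -/
def diffEnergy (F : (Fin n → ℝ) → E) (h : Fin n → ℝ) : ℝ := ∫ x, ‖F (x + h) - F x‖ ^ 2

theorem integrable_norm_sq_diff (hc : Continuous F) (hs : ∀ x, 3 ≤ ‖x‖ → F x = 0)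
    (h h' : Fin n → ℝ) : Integrable fun x => ‖F (x + h) - F (x + h')‖ ^ 2 := by
  refine Continuous.integrable_of_hasCompactSupport (by fun_prop) ?_
  refine HasCompactSupport.intro (isCompact_closedBall (0 : Fin n → ℝ) (3 + ‖h‖ + ‖h'‖)) ?_
  intro x hx
  rw [mem_closedBall_zero_iff, not_le] at hx
  have h1 : ‖x‖ ≤ ‖x + h‖ + ‖h‖ := by simpa using norm_sub_le (x + h) h
  have h2 : ‖x‖ ≤ ‖x + h'‖ + ‖h'‖ := by simpa using norm_sub_le (x + h') h'
  have := norm_nonneg h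
  have := norm_nonneg h'
  rw [hs (x + h) (by linarith), hs (x + h') (by linarith)]
  simp

theorem diffEnergy_le (hF : ∀ x y, ‖F x - F y‖ ≤ L * ‖x - y‖) (hs : ∀ x, 3 ≤ ‖x‖ → F x = 0)
    {h : Fin n → ℝ} (hh : ‖h‖ ≤ 1) : diffEnergy F h ≤ (L * ‖h‖) ^ 2 * 8 ^ n := by
  have hc := continuous_of_norm_sub_le hF
  have hz : ∀ x ∉ closedBall (0 : Fin n → ℝ) 4, ‖F (x + h) - F x‖ ^ 2 = 0 := by
    intro x hx
    rw [mem_closedBall_zero_iff, not_le] at hx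
    have h1 : ‖x‖ ≤ ‖x + h‖ + ‖h‖ := by simpa using norm_sub_le (x + h) h
    rw [hs (x + h) (by linarith), hs x (by linarith)]
    simp
  have hb : volume (closedBall (0 : Fin n → ℝ) 4) = ENNReal.ofReal (8 ^ n) := by
    rw [Real.volume_pi_closedBall _ (by norm_num)]; norm_num
  rw [diffEnergy, ← setIntegral_eq_integral_of_forall_compl_eq_zero hz]
  have := norm_setIntegral_le_of_norm_le_const (μ := volume)
    (s := closedBall (0 : Fin n → ℝ) 4) (f := fun x => ‖F (x + h) - F x‖ ^ 2)
    (C := (L * ‖h‖) ^ 2) (by rw [hb]; exact ENNReal.ofReal_lt_top) (by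
      intro x _
      rw [Real.norm_of_nonneg (by positivity)]
      have := hF (x + h) x
      rw [add_sub_cancel_left] at this
      gcongr)
  refine (le_abs_self _).trans (this.trans_eq ?_)
  rw [measureReal_def, hb, ENNReal.toReal_ofReal (by positivity)]

variable [InnerProductSpace ℝ E]

theorem norm_sq_secondDiff (u x : Fin n → ℝ) :
    ‖secondDiff F u x‖ ^ 2 = 2 * ‖F (x + (u + u)) - F (x + u)‖ ^ 2
      + 2 * ‖F (x + u) - F (x + 0)‖ ^ 2 - ‖F (x + (u + u)) - F (x + 0)‖ ^ 2 := by
  have := parallelogram_law_with_norm ℝ (F (x + (u + u)) - F (x + u)) (F (x + u) - F x)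
  rw [sub_add_sub_cancel] at this
  unfold secondDiff
  rw [add_zero]
  linarith

theorem integrable_norm_sq_secondDiff (hc : Continuous F) (hs : ∀ x, 3 ≤ ‖x‖ → F x = 0)
    (u : Fin n → ℝ) : Integrable fun x => ‖secondDiff F u x‖ ^ 2 := by
  simp only [norm_sq_secondDiff]
  have := integrable_norm_sq_diff hc hs
  exact (((this _ _).const_mul 2).add ((this _ _).const_mul 2)).sub (this _ _)

theorem integral_norm_sq_secondDiff (hc : Continuous F) (hs : ∀ x, 3 ≤ ‖x‖ → F x = 0)
    (u : Fin n → ℝ) :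
    ∫ x, ‖secondDiff F u x‖ ^ 2 = 4 * diffEnergy F u - diffEnergy F (u + u) := by
  simp only [norm_sq_secondDiff]
  have hi := integrable_norm_sq_diff hc hs
  have hi2 : Integrable fun x => 2 * ‖F (x + (u + u)) - F (x + u)‖ ^ 2
      + 2 * ‖F (x + u) - F (x + 0)‖ ^ 2 := ((hi _ _).const_mul 2).add ((hi _ _).const_mul 2)
  rw [integral_sub hi2 (hi _ _), integral_add ((hi _ _).const_mul 2) ((hi _ _).const_mul 2),
    integral_const_mul, integral_const_mul]
  have e : ∫ x, ‖F (x + (u + u)) - F (x + u)‖ ^ 2 = diffEnergy F u := by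
    simpa only [add_assoc, diffEnergy] using
      integral_add_right_eq_self (fun x => ‖F (x + u) - F x‖ ^ 2) u
  rw [e]
  simp only [add_zero, diffEnergy]
  ring

/-- The square function of second differences of a compactly supported Lipschitz map, over all
dyadic scales, is bounded. -/
theorem tsum_lintegral_secondDiff_le (hF : ∀ x y, ‖F x - F y‖ ≤ L * ‖x - y‖)
    (hs : ∀ x, 3 ≤ ‖x‖ → F x = 0) {v : Fin n → ℝ} (hv : ‖v‖ ≤ 1) :
    ∑' k : ℕ, ENNReal.ofReal (4 ^ k) *
      ∫⁻ x, ENNReal.ofReal (‖secondDiff F ((1 / 2 : ℝ) ^ (k + 1) • v) x‖ ^ 2)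
      ≤ ENNReal.ofReal (L ^ 2 * 8 ^ n) := by
  have hc := continuous_of_norm_sub_le hF
  have e : ∀ k : ℕ, ENNReal.ofReal (4 ^ k) *
      ∫⁻ x, ENNReal.ofReal (‖secondDiff F ((1 / 2 : ℝ) ^ (k + 1) • v) x‖ ^ 2) =
      ENNReal.ofReal (4 ^ k * ∫ x, ‖secondDiff F ((1 / 2 : ℝ) ^ (k + 1) • v) x‖ ^ 2) := by
    intro k
    rw [ENNReal.ofReal_mul (by positivity), ofReal_integral_eq_lintegral_ofReal
      (integrable_norm_sq_secondDiff hc hs _) (Eventually.of_forall fun x => by positivity)]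
  simp only [e]
  refine ENNReal.tsum_le_of_sum_range_le fun K => ?_
  rw [← ENNReal.ofReal_sum_of_nonneg fun k _ => by positivity]
  refine ENNReal.ofReal_le_ofReal ?_
  have t : ∀ k : ℕ, 4 ^ k * ∫ x, ‖secondDiff F ((1 / 2 : ℝ) ^ (k + 1) • v) x‖ ^ 2 =
      4 ^ (k + 1) * diffEnergy F ((1 / 2 : ℝ) ^ (k + 1) • v)
        - 4 ^ k * diffEnergy F ((1 / 2 : ℝ) ^ k • v) := by
    intro k
    have e2 : (1 / 2 : ℝ) ^ (k + 1) • v + (1 / 2 : ℝ) ^ (k + 1) • v = (1 / 2 : ℝ) ^ k • v := by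
      rw [← add_smul, pow_succ]; congr 1; ring
    rw [integral_norm_sq_secondDiff hc hs, e2]
    ring
  simp only [t]
  rw [Finset.sum_range_sub fun k => 4 ^ k * diffEnergy F ((1 / 2 : ℝ) ^ k • v)]
  have nn : ∀ h, 0 ≤ diffEnergy F h := fun h => integral_nonneg fun x => by positivity
  have hn : ‖(1 / 2 : ℝ) ^ K • v‖ = (1 / 2) ^ K * ‖v‖ := by
    rw [norm_smul, Real.norm_of_nonneg (by positivity)]
  have hle : ‖(1 / 2 : ℝ) ^ K • v‖ ≤ 1 := by
    rw [hn]; exact mul_le_one₀ (pow_le_one₀ (by norm_num) (by norm_num)) (norm_nonneg _) hv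
  have hd := diffEnergy_le hF hs hle
  rw [hn] at hd
  have h4 : (4:ℝ) ^ K * ((L * ((1 / 2) ^ K * ‖v‖)) ^ 2 * 8 ^ n) = L ^ 2 * 8 ^ n * ‖v‖ ^ 2 := by
    have : (4:ℝ) ^ K * ((1 / 2) ^ K) ^ 2 = 1 := by
      rw [← pow_mul, mul_comm K 2, pow_mul, ← mul_pow]; norm_num
    linear_combination (L ^ 2 * 8 ^ n * ‖v‖ ^ 2) * this
  have hv2 : ‖v‖ ^ 2 ≤ 1 := pow_le_one₀ (norm_nonneg _) hv
  calc _ ≤ (4:ℝ) ^ K * ((L * ((1 / 2) ^ K * ‖v‖)) ^ 2 * 8 ^ n) := by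
        refine (sub_le_self _ (mul_nonneg (by positivity) (nn _))).trans ?_
        gcongr
    _ = L ^ 2 * 8 ^ n * ‖v‖ ^ 2 := h4
    _ ≤ L ^ 2 * 8 ^ n := mul_le_of_le_one_right (by positivity) hv2

end Packing

/-! ### Cubes on which some second difference is large -/

section Oscillating

variable {n : ℕ} {E : Type*} [NormedAddCommGroup E] {F : (Fin n → ℝ) → E} {L : ℝ}

/-- A dyadic cube is oscillating if, for some increment in the finite set `V`, the second
difference of `F` at the scale of the cube has mean square at least `θ` on it. -/
def IsOscillating (F : (Fin n → ℝ) → E) (θ : ℝ) (V : Set (Fin n → ℝ)) (k : ℕ)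
    (j : Fin n → ℤ) : Prop :=
  ∃ v ∈ V, ENNReal.ofReal (θ * (1 / 4) ^ k) * volume (dyadicCube k j) ≤
    ∫⁻ x in dyadicCube k j, ENNReal.ofReal (‖secondDiff F ((1 / 2 : ℝ) ^ (k + 1) • v) x‖ ^ 2)

open Classical in
/-- Carleson packing of the oscillating cubes. -/
theorem tsum_volume_isOscillating_le [InnerProductSpace ℝ E]
    (hF : ∀ x y, ‖F x - F y‖ ≤ L * ‖x - y‖)
    (hs : ∀ x, 3 ≤ ‖x‖ → F x = 0) {V : Finset (Fin n → ℝ)} (hV : ∀ v ∈ V, ‖v‖ ≤ 1)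
    {θ : ℝ} (hθ : 0 < θ) :
    ∑' c : ℕ × (Fin n → ℤ),
      (if IsOscillating F θ V c.1 c.2 then volume (dyadicCube c.1 c.2) else 0)
      ≤ V.card * (ENNReal.ofReal θ⁻¹ * ENNReal.ofReal (L ^ 2 * 8 ^ n)) := by
  let g : ℕ → (Fin n → ℝ) → (Fin n → ℝ) → ℝ≥0∞ := fun k v x =>
    ENNReal.ofReal (‖secondDiff F ((1 / 2 : ℝ) ^ (k + 1) • v) x‖ ^ 2)
  have h1 : ∀ (k : ℕ) (j : Fin n → ℤ),
      (if IsOscillating F θ V k j then volume (dyadicCube k j) else 0) ≤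
      ∑ v ∈ V, ENNReal.ofReal θ⁻¹ * (ENNReal.ofReal (4 ^ k) *
        ∫⁻ x in dyadicCube k j, g k v x) := by
    intro k j
    split_ifs with h
    · obtain ⟨v, hv, h⟩ := h
      refine le_trans ?_ (Finset.single_le_sum
        (f := fun v => ENNReal.ofReal θ⁻¹ * (ENNReal.ofReal (4 ^ k) *
          ∫⁻ x in dyadicCube k j, g k v x)) (fun _ _ => zero_le) (Finset.mem_coe.1 hv))
      refine le_trans (le_of_eq ?_) (mul_le_mul_right (mul_le_mul_right h _) _)
      rw [← mul_assoc, ← mul_assoc, ← ENNReal.ofReal_mul (by positivity),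
        ← ENNReal.ofReal_mul (by positivity)]
      have : θ⁻¹ * 4 ^ k * (θ * (1 / 4) ^ k) = 1 := by
        have h4 : (4:ℝ) ^ k * (1 / 4) ^ k = 1 := by rw [← mul_pow]; norm_num
        have := inv_mul_cancel₀ hθ.ne'
        linear_combination (θ⁻¹ * θ) * h4 + this
      rw [this]; simp
    · exact zero_le
  calc _ = ∑' k : ℕ, ∑' j : Fin n → ℤ,
        (if IsOscillating F θ V k j then volume (dyadicCube k j) else 0) :=
        ENNReal.tsum_prod (f := fun k j =>
          if IsOscillating F θ V k j then volume (dyadicCube k j) else 0)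
    _ ≤ ∑' k : ℕ, ∑' j : Fin n → ℤ, ∑ v ∈ V, ENNReal.ofReal θ⁻¹ * (ENNReal.ofReal (4 ^ k) *
        ∫⁻ x in dyadicCube k j, g k v x) :=
        ENNReal.tsum_le_tsum fun k => ENNReal.tsum_le_tsum fun j => h1 k j
    _ = ∑ v ∈ V, ∑' k : ℕ, ENNReal.ofReal θ⁻¹ * (ENNReal.ofReal (4 ^ k) *
        ∑' j : Fin n → ℤ, ∫⁻ x in dyadicCube k j, g k v x) := by
        simp_rw [Summable.tsum_finsetSum fun _ _ => ENNReal.summable, ENNReal.tsum_mul_left]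
    _ ≤ ∑ v ∈ V, ENNReal.ofReal θ⁻¹ * ENNReal.ofReal (L ^ 2 * 8 ^ n) := by
        refine Finset.sum_le_sum fun v hv => ?_
        rw [ENNReal.tsum_mul_left]
        refine mul_le_mul_right (le_trans ?_ (tsum_lintegral_secondDiff_le hF hs (hV v hv))) _
        refine ENNReal.tsum_le_tsum fun k => mul_le_mul_right ?_ _
        rw [← lintegral_iUnion (measurableSet_dyadicCube k)
          fun i j hij => disjoint_dyadicCube hij]
        exact setLIntegral_le_lintegral _ _
    _ = _ := by rw [Finset.sum_const, nsmul_eq_mul]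

theorem norm_secondDiff_le_of_not_isOscillating (hL : 0 < L)
    (hF : ∀ x y, ‖F x - F y‖ ≤ L * ‖x - y‖) {η ρ θ : ℝ} (hη : 0 < η) (hρ : 0 < ρ) (hρ1 : ρ ≤ 1)
    (hρη : 16 * L * ρ ≤ η) (hθ : θ ≤ (η / 2) ^ 2 * ρ ^ n)
    {V : Set (Fin n → ℝ)} (hV : closedBall 0 1 ⊆ ⋃ v ∈ V, ball v ρ) {k : ℕ} {j : Fin n → ℤ}
    (hj : ¬ IsOscillating F θ V k j) {a u : Fin n → ℝ} (ha : a ∈ dyadicCube k j)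
    (hau : a + (u + u) ∈ dyadicCube k j) : ‖secondDiff F u a‖ ≤ η * (1 / 2) ^ k := by
  by_contra! hcon
  apply hj
  have hk : (0:ℝ) < (1 / 2) ^ k := by positivity
  have hu : ‖u‖ ≤ (1 / 2) ^ (k + 1) := by
    have := norm_sub_le_of_mem_dyadicCube hau ha
    rw [add_sub_cancel_left, ← two_smul ℝ u, norm_smul] at this
    norm_num at this
    rw [pow_succ]; norm_num; linarith
  have hmem : (2:ℝ) ^ (k + 1) • u ∈ closedBall (0 : Fin n → ℝ) 1 := by
    rw [mem_closedBall_zero_iff, norm_smul, Real.norm_of_nonneg (by positivity)]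
    calc _ ≤ (2:ℝ) ^ (k + 1) * (1 / 2) ^ (k + 1) := by gcongr
      _ = 1 := by rw [← mul_pow]; norm_num
  obtain ⟨v, hv, hvu⟩ := mem_iUnion₂.1 (hV hmem)
  refine ⟨v, hv, ?_⟩
  have huv : ‖(1 / 2 : ℝ) ^ (k + 1) • v - u‖ ≤ (1 / 2) ^ k * ρ := by
    have e : u = (1 / 2 : ℝ) ^ (k + 1) • ((2:ℝ) ^ (k + 1) • u) := by
      rw [smul_smul, ← mul_pow]; norm_num
    rw [mem_ball, dist_eq_norm, norm_sub_rev] at hvu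
    rw [e, ← smul_sub, norm_smul, Real.norm_of_nonneg (by positivity)]
    exact mul_le_mul (pow_le_pow_of_le_one (by norm_num) (by norm_num) (Nat.le_succ k)) hvu.le
      (norm_nonneg _) (by positivity)
  set w := (1 / 2 : ℝ) ^ (k + 1) • v
  set A := AffineMap.homothety a ρ '' dyadicCube k j
  have hA : A ⊆ dyadicCube k j := by
    rintro _ ⟨x, hx, rfl⟩
    rw [AffineMap.homothety_eq_lineMap]
    exact (convex_dyadicCube k j).lineMap_mem ha hx ⟨hρ.le, hρ1⟩
  have hAle : ∀ x ∈ A, (η / 2 * (1 / 2) ^ k) ^ 2 ≤ ‖secondDiff F w x‖ ^ 2 := by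
    rintro _ ⟨x, hx, rfl⟩
    have hd : ‖AffineMap.homothety a ρ x - a‖ ≤ (1 / 2) ^ k * ρ := by
      rw [AffineMap.homothety_apply, vsub_eq_sub, vadd_eq_add, add_sub_cancel_right, norm_smul,
        Real.norm_of_nonneg hρ.le, mul_comm]
      have := norm_sub_le_of_mem_dyadicCube hx ha
      gcongr
    have h1 := norm_secondDiff_sub_le hF u w a (AffineMap.homothety a ρ x)
    rw [norm_sub_rev a, norm_sub_rev u] at h1
    have h2 : 4 * L * (‖AffineMap.homothety a ρ x - a‖ + ‖w - u‖) ≤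
        4 * L * ((1 / 2) ^ k * ρ + (1 / 2) ^ k * ρ) := by gcongr
    have h3 := norm_sub_norm_le (secondDiff F u a) (secondDiff F w (AffineMap.homothety a ρ x))
    have h4 : 16 * L * ρ * (1 / 2) ^ k ≤ η * (1 / 2) ^ k := by gcongr
    have h5 : 0 < L * ρ * (1 / 2) ^ k := by positivity
    refine pow_le_pow_left₀ (by positivity) ?_ 2
    nlinarith
  have hvol : volume A = ENNReal.ofReal (ρ ^ n) * volume (dyadicCube k j) := by
    rw [Measure.addHaar_image_homothety, Module.finrank_fin_fun, abs_of_pos (by positivity)]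
  calc _ ≤ ENNReal.ofReal ((η / 2 * (1 / 2) ^ k) ^ 2) * volume A := by
        rw [hvol, ← mul_assoc, ← ENNReal.ofReal_mul (by positivity)]
        refine mul_le_mul_left (ENNReal.ofReal_le_ofReal ?_) _
        have e : (1 / 4 : ℝ) ^ k = ((1 / 2) ^ k) ^ 2 := by
          rw [← pow_mul, mul_comm, pow_mul]; norm_num
        calc θ * (1 / 4) ^ k ≤ (η / 2) ^ 2 * ρ ^ n * (1 / 4) ^ k := by gcongr
          _ = (η / 2 * (1 / 2) ^ k) ^ 2 * ρ ^ n := by rw [e]; ring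
    _ = ∫⁻ _ in A, ENNReal.ofReal ((η / 2 * (1 / 2) ^ k) ^ 2) := by rw [setLIntegral_const]
    _ ≤ ∫⁻ x in A, ENNReal.ofReal (‖secondDiff F w x‖ ^ 2) := by
        have hc := continuous_secondDiff (continuous_of_norm_sub_le hF) w
        exact setLIntegral_mono (hc.norm.pow 2).measurable.ennreal_ofReal fun x hx => ENNReal.ofReal_le_ofReal (hAle x hx)
    _ ≤ _ := lintegral_mono_set hA

end Oscillating

/-! ### Cubes with small image -/

section Collapse

variable {n : ℕ} {E : Type*} [NormedAddCommGroup E] {F : (Fin n → ℝ) → E} {L ε : ℝ}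
  {Q : Set (Fin n → ℝ)}

theorem norm_translate_sub_le_of_secondDiff
    (hQ : ∀ a u, a ∈ Q → a + (u + u) ∈ Q → ‖secondDiff F u a‖ ≤ ε) {x w : Fin n → ℝ}
    (hx : x ∈ Q) (hxw : x + w ∈ Q) (hw : ‖F (x + w) - F x‖ ≤ ε) {a : Fin n → ℝ} (ha : a ∈ Q)
    (haw : a + w ∈ Q) : ‖F (a + w) - F a‖ ≤ 3 * ε := by
  have e1 : x + ((1 / 2 : ℝ) • (a + w - x) + (1 / 2 : ℝ) • (a + w - x)) = a + w := by
    rw [← add_smul]; norm_num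
  have e2 : a + ((1 / 2 : ℝ) • (x + w - a) + (1 / 2 : ℝ) • (x + w - a)) = x + w := by
    rw [← add_smul]; norm_num
  have e3 : a + (1 / 2 : ℝ) • (x + w - a) = x + (1 / 2 : ℝ) • (a + w - x) := by
    ext i; simp; ring
  have h1 := hQ x ((1 / 2 : ℝ) • (a + w - x)) hx (by rwa [e1])
  have h2 := hQ a ((1 / 2 : ℝ) • (x + w - a)) ha (by rwa [e2])
  have e : F (a + w) - F a = (secondDiff F ((1 / 2 : ℝ) • (a + w - x)) x
      - secondDiff F ((1 / 2 : ℝ) • (x + w - a)) a) + (F (x + w) - F x) := by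
    unfold secondDiff
    rw [e1, e2, e3]; abel
  rw [e]
  calc _ ≤ ‖secondDiff F ((1 / 2 : ℝ) • (a + w - x)) x‖
      + ‖secondDiff F ((1 / 2 : ℝ) • (x + w - a)) a‖ + ‖F (x + w) - F x‖ :=
        (norm_add_le _ _).trans (by gcongr; exact norm_sub_le _ _)
    _ ≤ 3 * ε := by linarith

theorem norm_translate_nsmul_sub_le {w : Fin n → ℝ} {C : ℝ}
    (hw : ∀ a ∈ Q, a + w ∈ Q → ‖F (a + w) - F a‖ ≤ C) {z : Fin n → ℝ} (t : ℕ)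
    (hz : ∀ s ≤ t, z + s • w ∈ Q) : ‖F (z + t • w) - F z‖ ≤ t * C := by
  induction t with
  | zero => simp
  | succ t ih =>
    have h1 := ih fun s hs => hz s (hs.trans (Nat.le_succ t))
    have e : z + (t + 1) • w = z + t • w + w := by rw [add_smul, one_smul, add_assoc]
    have h2 := hw _ (hz t (Nat.le_succ t)) (by rw [← e]; exact hz _ le_rfl)
    rw [e]
    calc _ = ‖(F (z + t • w + w) - F (z + t • w)) + (F (z + t • w) - F z)‖ := by
          rw [sub_add_sub_cancel]
      _ ≤ C + t * C := (norm_add_le _ _).trans (add_le_add h2 h1)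
      _ = _ := by push_cast; ring

variable {k : ℕ} {j : Fin n → ℤ}

/-- If second differences are small on a cube and `F` almost identifies two points of the cube
at distance comparable to a small multiple of its side, then every value of `F` on the cube is
nearly attained close to the boundary of the cube. -/
theorem exists_near_boundary {A : ℕ} (hA : 0 < A) (hε : 0 ≤ ε)
    (hQ : ∀ a u, a ∈ dyadicCube k j → a + (u + u) ∈ dyadicCube k j → ‖secondDiff F u a‖ ≤ ε)
    {x y : Fin n → ℝ} (hx : x ∈ dyadicCube k j) (hy : y ∈ dyadicCube k j)
    (hxy : (1 / 2) ^ k / (2 * A) ≤ ‖y - x‖) (hxy' : ‖y - x‖ ≤ (1 / 2) ^ k / A)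
    (hFxy : ‖F y - F x‖ ≤ ε) {z : Fin n → ℝ} (hz : z ∈ dyadicCube k j) :
    ∃ z' ∈ dyadicCube k j, ‖F z' - F z‖ ≤ 6 * A * ε ∧
      ∃ i, 2 ^ k * z' i - j i < 1 / A ∨ 1 - 1 / A ≤ 2 ^ k * z' i - j i := by
  classical
  have hA' : (0:ℝ) < A := by exact_mod_cast hA
  have h2k : (2:ℝ) ^ k * (1 / 2) ^ k = 1 := by rw [← mul_pow]; norm_num
  obtain ⟨w, rfl⟩ : ∃ w, y = x + w := ⟨y - x, by abel⟩
  rw [add_sub_cancel_left] at hxy hxy'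
  have hslide := fun a ha => norm_translate_sub_le_of_secondDiff hQ hx hy hFxy (a := a) ha
  obtain ⟨i, hi⟩ : ∃ i, (1 / 2) ^ k / (2 * A) ≤ |w i| := by
    by_contra! h
    exact absurd hxy (not_le.2 ((pi_norm_lt_iff (by positivity)).2 h))
  have hout : z + (2 * A) • w ∉ dyadicCube k j := by
    intro h
    have hz := hz
    rw [mem_dyadicCube_iff] at h hz
    obtain ⟨a1, a2⟩ := h i
    obtain ⟨b1, b2⟩ := hz i
    have e : (2:ℝ) ^ k * (z + (2 * A) • w) i = 2 ^ k * z i + 2 ^ k * (2 * A) * w i := by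
      simp; ring
    rw [e] at a1 a2
    have h1 : 1 ≤ |(2:ℝ) ^ k * (2 * A) * w i| := by
      rw [abs_mul, abs_of_pos (by positivity)]
      calc (1:ℝ) = 2 ^ k * (2 * A) * ((1 / 2) ^ k / (2 * A)) := by
            field_simp; linarith
        _ ≤ _ := by gcongr
    rcases le_abs.1 h1 with h | h <;> linarith
  have hex : ∃ t : ℕ, z + t • w ∉ dyadicCube k j := ⟨_, hout⟩
  have hT : Nat.find hex ≤ 2 * A := Nat.find_min' hex hout
  obtain ⟨S, hS⟩ : ∃ S, Nat.find hex = S + 1 := Nat.exists_eq_succ_of_ne_zero fun h0 => by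
    have := Nat.find_spec hex
    rw [h0, zero_smul, add_zero] at this
    exact this hz
  have hin : ∀ s ≤ S, z + s • w ∈ dyadicCube k j := fun s hs =>
    not_not.1 (Nat.find_min hex (by omega))
  refine ⟨z + S • w, hin S le_rfl, ?_, ?_⟩
  · refine (norm_translate_nsmul_sub_le hslide S hin).trans ?_
    have : (S : ℝ) ≤ 2 * A := by exact_mod_cast (by omega : S ≤ 2 * A)
    calc (S : ℝ) * (3 * ε) ≤ 2 * A * (3 * ε) := by gcongr
      _ = _ := by ring
  · have hnot := Nat.find_spec hex
    rw [hS, mem_dyadicCube_iff] at hnot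
    push Not at hnot
    obtain ⟨i, hi⟩ := hnot
    refine ⟨i, ?_⟩
    have e : (2:ℝ) ^ k * (z + (S + 1) • w) i = 2 ^ k * (z + S • w) i + 2 ^ k * w i := by
      simp; ring
    rw [e] at hi
    have hwi : |(2:ℝ) ^ k * w i| ≤ 1 / A := by
      rw [abs_mul, abs_of_pos (by positivity)]
      calc (2:ℝ) ^ k * |w i| ≤ 2 ^ k * ((1 / 2) ^ k / A) := by
            gcongr; exact (norm_le_pi_norm w i).trans hxy'
        _ = _ := by rw [← mul_div_assoc, h2k]
    rw [abs_le] at hwi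
    by_contra! hcon
    linarith [hi (by linarith)]

theorem card_filter_apply_eq {A : ℕ} (i : Fin n) (c : Fin A) :
    (Finset.univ.filter fun b : Fin n → Fin A => b i = c).card = A ^ (n - 1) := by
  have : (Finset.univ.filter fun b : Fin n → Fin A => b i = c) =
      Fintype.piFinset fun l => if l = i then {c} else Finset.univ := by
    ext b
    simp only [Finset.mem_filter, Finset.mem_univ, true_and, Fintype.mem_piFinset]
    constructor
    · intro h l
      split_ifs with hl
      · subst hl; simp [h]
      · simp
    · intro h; simpa using h i
  rw [this, Fintype.card_piFinset, ← Finset.mul_prod_erase _ _ (Finset.mem_univ i)]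
  rw [Finset.prod_congr rfl (g := fun _ => A)]
  · simp
  · intro l hl
    simp [Finset.ne_of_mem_erase hl]

/-- A cube as in `exists_near_boundary` has an image of small content. -/
theorem hContent_image_dyadicCube_le (hn : 0 < n) (hL : 0 < L)
    (hF : ∀ x y, ‖F x - F y‖ ≤ L * ‖x - y‖) {A : ℕ} (hA : 0 < A) (hε : 0 ≤ ε)
    (hεA : ε ≤ L / A ^ 2 * (1 / 2) ^ k)
    (hQ : ∀ a u, a ∈ dyadicCube k j → a + (u + u) ∈ dyadicCube k j → ‖secondDiff F u a‖ ≤ ε)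
    {x y : Fin n → ℝ} (hx : x ∈ dyadicCube k j) (hy : y ∈ dyadicCube k j)
    (hxy : (1 / 2) ^ k / (2 * A) ≤ ‖y - x‖) (hxy' : ‖y - x‖ ≤ (1 / 2) ^ k / A)
    (hFxy : ‖F y - F x‖ ≤ ε) :
    hContent n (F '' dyadicCube k j) ≤
      ENNReal.ofReal (2 * n * (13 * L) ^ n / A) * volume (dyadicCube k j) := by
  obtain ⟨B, rfl⟩ : ∃ B, A = B + 1 := Nat.exists_eq_succ_of_ne_zero hA.ne'
  have hA' : (0:ℝ) < (B + 1 : ℕ) := by exact_mod_cast hA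
  have hd : (0:ℝ) < n := by exact_mod_cast hn
  have h2k : (2:ℝ) ^ k * (1 / 2) ^ k = 1 := by rw [← mul_pow]; norm_num
  set A := B + 1
  let T : Finset (Fin n → Fin A) := Finset.univ.biUnion fun i =>
    (Finset.univ.filter fun b => b i = 0) ∪ (Finset.univ.filter fun b => b i = Fin.last B)
  let sub : (Fin n → Fin A) → Set (Fin n → ℝ) := fun b =>
    {z | ∀ i, ⌊(A:ℝ) * (2 ^ k * z i - j i)⌋ = ((b i : ℕ) : ℤ)}
  let U : (Fin n → Fin A) → Set E := fun b =>
    {p | ∃ z' ∈ sub b, ‖F z' - p‖ ≤ 6 * A * ε}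
  have hcover : F '' dyadicCube k j ⊆ ⋃ b : T, U b := by
    rintro _ ⟨z, hz, rfl⟩
    obtain ⟨z', hz', h1, i, hi⟩ := exists_near_boundary hA hε hQ hx hy hxy hxy' hFxy hz
    rw [mem_dyadicCube_iff] at hz'
    have hfl : ∀ l, 0 ≤ ⌊(A:ℝ) * (2 ^ k * z' l - j l)⌋ ∧ ⌊(A:ℝ) * (2 ^ k * z' l - j l)⌋ < A := by
      intro l
      obtain ⟨h3, h4⟩ := hz' l
      refine ⟨Int.floor_nonneg.2 (mul_nonneg hA'.le (by linarith)), Int.floor_lt.2 ?_⟩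
      rw [Int.cast_natCast]
      exact mul_lt_of_lt_one_right hA' (by linarith)
    let b : Fin n → Fin A := fun l => ⟨⌊(A:ℝ) * (2 ^ k * z' l - j l)⌋.toNat, by
      have := hfl l; omega⟩
    have hb : ∀ l, ⌊(A:ℝ) * (2 ^ k * z' l - j l)⌋ = ((b l : ℕ) : ℤ) := fun l => by
      have := hfl l; simp only [b]; omega
    refine mem_iUnion.2 ⟨⟨b, ?_⟩, z', hb, h1⟩
    simp only [T, Finset.mem_biUnion, Finset.mem_univ, true_and, Finset.mem_union,
      Finset.mem_filter]
    refine ⟨i, ?_⟩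
    have hbi := hb i
    rcases hi with hi | hi
    · left
      have : ⌊(A:ℝ) * (2 ^ k * z' i - j i)⌋ < 1 := Int.floor_lt.2 (by
        rw [lt_div_iff₀ hA'] at hi; push_cast at hi ⊢; linarith)
      apply Fin.ext
      simp only [Fin.val_zero]; omega
    · right
      have h5 : (B : ℤ) ≤ ⌊(A:ℝ) * (2 ^ k * z' i - j i)⌋ := Int.le_floor.2 (by
        have e : (A:ℝ) * (1 - 1 / A) = B := by
          rw [mul_sub, mul_one_div_cancel hA'.ne']; simp [A]
        calc ((B : ℤ) : ℝ) = A * (1 - 1 / A) := by rw [e]; simp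
          _ ≤ _ := by gcongr)
      have h6 := (b i).isLt
      apply Fin.ext
      simp only [Fin.val_last]; omega
  have hU : ∀ b, hContent n (U b) ≤ ENNReal.ofReal (13 * L / A * (1 / 2) ^ k) ^ n := by
    intro b
    refine (hContent_le_diam hd _).trans ?_
    rw [ENNReal.rpow_natCast]
    gcongr
    refine Metric.ediam_le fun p hp q hq => ?_
    rw [edist_dist]
    refine ENNReal.ofReal_le_ofReal ?_
    obtain ⟨z, hz, hzp⟩ := hp
    obtain ⟨w, hw, hwq⟩ := hq
    have hzw : ‖z - w‖ ≤ (1 / 2) ^ k / A := by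
      rw [pi_norm_le_iff_of_nonneg (by positivity)]
      intro i
      have h := Int.abs_sub_lt_one_of_floor_eq_floor ((hz i).trans (hw i).symm)
      have e : (A:ℝ) * (2 ^ k * z i - j i) - A * (2 ^ k * w i - j i) = A * 2 ^ k * (z i - w i) := by
        ring
      rw [e, abs_mul, abs_of_pos (by positivity)] at h
      rw [Real.norm_eq_abs, Pi.sub_apply, le_div_iff₀ hA']
      calc |z i - w i| * A = (1 / 2) ^ k * (A * 2 ^ k * |z i - w i|) := by
            linear_combination (-(A:ℝ) * |z i - w i|) * h2k
        _ ≤ (1 / 2) ^ k * 1 := by gcongr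
        _ = _ := mul_one _
    have e : p - q = -(F z - p) + (F z - F w) + (F w - q) := by abel
    rw [dist_eq_norm, e]
    calc _ ≤ ‖F z - p‖ + ‖F z - F w‖ + ‖F w - q‖ := by
          refine (norm_add_le _ _).trans ?_
          gcongr
          refine (norm_add_le _ _).trans ?_
          rw [norm_neg]
      _ ≤ 6 * A * (L / A ^ 2 * (1 / 2) ^ k) + L * ((1 / 2) ^ k / A)
          + 6 * A * (L / A ^ 2 * (1 / 2) ^ k) := by
          have h3 : 6 * A * ε ≤ 6 * A * (L / A ^ 2 * (1 / 2) ^ k) := by gcongr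
          have h4 : L * ‖z - w‖ ≤ L * ((1 / 2) ^ k / A) := by gcongr
          have h5 := hF z w
          linarith
      _ = _ := by field_simp; ring
  have hT : T.card ≤ 2 * n * A ^ (n - 1) := by
    refine Finset.card_biUnion_le.trans ?_
    calc _ ≤ ∑ _i : Fin n, (A ^ (n - 1) + A ^ (n - 1)) := by
          refine Finset.sum_le_sum fun i _ => (Finset.card_union_le _ _).trans ?_
          rw [card_filter_apply_eq, card_filter_apply_eq]
      _ = _ := by simp; ring
  calc _ ≤ hContent n (⋃ b : T, U b) := hContent_mono hd hcover
    _ ≤ ∑' b : T, hContent n (U b) := hContent_iUnion_le hd _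
    _ ≤ ∑' _b : T, ENNReal.ofReal (13 * L / A * (1 / 2) ^ k) ^ n :=
        ENNReal.tsum_le_tsum fun b => hU b
    _ = T.card * ENNReal.ofReal (13 * L / A * (1 / 2) ^ k) ^ n := by
        rw [tsum_fintype, Finset.sum_const, nsmul_eq_mul]; simp
    _ ≤ ENNReal.ofReal (2 * n * A ^ (n - 1)) *
        (ENNReal.ofReal ((13 * L / A) ^ n) * volume (dyadicCube k j)) := by
        rw [volume_dyadicCube, ENNReal.ofReal_mul (by positivity), mul_pow,
          ENNReal.ofReal_pow (p := 13 * L / A) (by positivity)]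
        gcongr
        rw [← ENNReal.ofReal_natCast]
        exact ENNReal.ofReal_le_ofReal (by exact_mod_cast hT)
    _ = _ := by
        rw [← mul_assoc, ← ENNReal.ofReal_mul (by positivity)]
        congr 2
        obtain ⟨q, rfl⟩ : ∃ q, n = q + 1 := Nat.exists_eq_succ_of_ne_zero hn.ne'
        rw [div_pow, Nat.add_sub_cancel]
        field_simp
        ring

end Collapse

/-! ### Families of dyadic cubes -/

section Families

variable {n : ℕ} {E : Type*} [NormedAddCommGroup E] {F : (Fin n → ℝ) → E} {L : ℝ}

theorem hContent_image_dyadicCube_le_volume (hn : 0 < n) (hL : 0 ≤ L)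
    (hF : ∀ x y, ‖F x - F y‖ ≤ L * ‖x - y‖) (k : ℕ) (j : Fin n → ℤ) :
    hContent n (F '' dyadicCube k j) ≤ ENNReal.ofReal L ^ n * volume (dyadicCube k j) := by
  refine (hContent_le_diam (by exact_mod_cast hn) _).trans ?_
  rw [ENNReal.rpow_natCast, volume_dyadicCube, ← mul_pow, ← ENNReal.ofReal_mul hL]
  gcongr
  refine Metric.ediam_le ?_
  rintro _ ⟨x, hx, rfl⟩ _ ⟨y, hy, rfl⟩
  rw [edist_dist, dist_eq_norm]
  refine ENNReal.ofReal_le_ofReal ((hF x y).trans ?_)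
  have := norm_sub_le_of_mem_dyadicCube hx hy
  gcongr

theorem hContent_image_biUnion_dyadicCube_le (hn : 0 < n) {κ : ℝ≥0∞}
    (S : Set (ℕ × (Fin n → ℤ)))
    (hS : ∀ c ∈ S, hContent n (F '' dyadicCube c.1 c.2) ≤ κ * volume (dyadicCube c.1 c.2)) :
    hContent n (F '' ⋃ c : S, dyadicCube c.1.1 c.1.2) ≤
      κ * ∑' c : S, volume (dyadicCube c.1.1 c.1.2) := by
  rw [image_iUnion, ← ENNReal.tsum_mul_left]
  exact (hContent_iUnion_le (by exact_mod_cast hn) _).trans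
    (ENNReal.tsum_le_tsum fun c => hS c c.2)

/-- A stopping time argument: the maximal cubes of a family are disjoint. -/
theorem hContent_image_exists_dyadicCube_le (hn : 0 < n) {κ : ℝ≥0∞}
    (P : ℕ → (Fin n → ℤ) → Prop)
    (hP : ∀ k j, P k j → hContent n (F '' dyadicCube k j) ≤ κ * volume (dyadicCube k j)) :
    hContent n (F '' {x | ‖x‖ ≤ 1 ∧ ∃ k, P k (dyadicIndex k x)}) ≤
      κ * ENNReal.ofReal (4 ^ n) := by
  classical
  let S : Set (ℕ × (Fin n → ℤ)) := {c | P c.1 c.2 ∧ ∃ x ∈ dyadicCube c.1 c.2, ‖x‖ ≤ 1 ∧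
    ∀ i < c.1, ¬ P i (dyadicIndex i x)}
  have hcover : {x | ‖x‖ ≤ 1 ∧ ∃ k, P k (dyadicIndex k x)} ⊆
      ⋃ c : S, dyadicCube c.1.1 c.1.2 := by
    rintro x ⟨hx, hex⟩
    refine mem_iUnion.2 ⟨⟨(Nat.find hex, dyadicIndex _ x), Nat.find_spec hex, x, rfl, hx, ?_⟩, rfl⟩
    exact fun i hi => Nat.find_min hex hi
  have hsep : ∀ c ∈ S, ∀ c' ∈ S, ∀ z ∈ dyadicCube c.1 c.2, z ∈ dyadicCube c'.1 c'.2 →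
      c.1 < c'.1 → False := by
    rintro ⟨k, j⟩ ⟨h1, -⟩ ⟨k', j'⟩ ⟨-, x', hx', -, h2⟩ z hz hz' hlt
    apply h2 k hlt
    have : dyadicIndex k x' = dyadicIndex k z := dyadicIndex_eq_of_le hlt.le (hx'.trans hz'.symm)
    rw [this, show dyadicIndex k z = j from hz]
    exact h1
  have hdisj : Pairwise (Function.onFun Disjoint fun c : S => dyadicCube c.1.1 c.1.2) := by
    rintro ⟨c, hc⟩ ⟨c', hc'⟩ hne
    rw [Function.onFun, Set.disjoint_left]
    intro z hz hz'
    rcases lt_trichotomy c.1 c'.1 with h | h | h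
    · exact hsep c hc c' hc' z hz hz' h
    · have h1 : dyadicIndex c.1 z = c.2 := hz
      have h2 : dyadicIndex c'.1 z = c'.2 := hz'
      rw [h] at h1
      exact hne (Subtype.ext (Prod.ext h (h1.symm.trans h2)))
    · exact hsep c' hc' c hc z hz' hz h
  have hball : (⋃ c : S, dyadicCube c.1.1 c.1.2) ⊆ closedBall (0 : Fin n → ℝ) 2 := by
    refine iUnion_subset ?_
    intro c z hz
    obtain ⟨-, x, hx, hx1, -⟩ := c.2
    rw [mem_closedBall_zero_iff]
    have h1 := norm_sub_le_of_mem_dyadicCube hz hx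
    have h2 : (1 / 2 : ℝ) ^ c.1.1 ≤ 1 := pow_le_one₀ (by norm_num) (by norm_num)
    have h3 := norm_sub_norm_le z x
    linarith
  refine (hContent_mono (by exact_mod_cast hn) (image_mono hcover)).trans
    ((hContent_image_biUnion_dyadicCube_le hn S fun c hc => hP _ _ hc.1).trans ?_)
  refine mul_le_mul_right ?_ _
  refine (tsum_meas_le_meas_iUnion_of_disjoint volume
    (fun c : S => measurableSet_dyadicCube c.1.1 c.1.2) hdisj).trans
    ((measure_mono hball).trans ?_)
  rw [Real.volume_pi_closedBall _ (by norm_num)]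
  norm_num

open Classical in
theorem count_dyadicIndex_congr (P : ℕ → (Fin n → ℤ) → Prop) {k : ℕ} {x y : Fin n → ℝ}
    (h : dyadicIndex k x = dyadicIndex k y) :
    Nat.count (fun i => P i (dyadicIndex i x)) k = Nat.count (fun i => P i (dyadicIndex i y)) k := by
  rw [Nat.count_eq_card_filter_range, Nat.count_eq_card_filter_range]
  congr 1
  refine Finset.filter_congr fun i hi => ?_
  rw [dyadicIndex_eq_of_le (Finset.mem_range.1 hi).le h]

open Classical in
/-- Points lying in many cubes of a family with a packing condition have an image of small
content. -/
theorem hContent_image_count_le (hn : 0 < n) (hL : 0 ≤ L)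
    (hF : ∀ x y, ‖F x - F y‖ ≤ L * ‖x - y‖) (P : ℕ → (Fin n → ℤ) → Prop) {M : ℕ} (hM : 0 < M) :
    M * hContent n (F '' {x | ∃ k, M ≤ Nat.count (fun i => P i (dyadicIndex i x)) k}) ≤
      ENNReal.ofReal L ^ n * ∑' c : ℕ × (Fin n → ℤ),
        (if P c.1 c.2 then volume (dyadicCube c.1 c.2) else 0) := by
  let corner : ℕ × (Fin n → ℤ) → Fin n → ℝ := fun c i => (c.2 i : ℝ) / 2 ^ c.1
  have hcorner : ∀ c, dyadicIndex c.1 (corner c) = c.2 := by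
    intro c
    ext i
    have : (2:ℝ) ^ c.1 * (c.2 i / 2 ^ c.1) = c.2 i := mul_div_cancel₀ _ (by positivity)
    simp only [dyadicIndex, corner, this, Int.floor_intCast]
  let rank : ℕ × (Fin n → ℤ) → ℕ := fun c =>
    Nat.count (fun i => P i (dyadicIndex i (corner c))) c.1
  let s : ℕ → ℝ≥0∞ := fun r => ∑' c : ℕ × (Fin n → ℤ),
    if P c.1 c.2 ∧ rank c = r then volume (dyadicCube c.1 c.2) else 0
  obtain ⟨r, hr, hmin⟩ := Finset.exists_min_image (Finset.range M) s
    (Finset.nonempty_range_iff.2 hM.ne')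
  have hsum : M * s r ≤ ∑' c : ℕ × (Fin n → ℤ),
        (if P c.1 c.2 then volume (dyadicCube c.1 c.2) else 0) := by
    calc M * s r = (Finset.range M).card • s r := by simp
      _ ≤ ∑ r' ∈ Finset.range M, s r' := Finset.card_nsmul_le_sum _ _ _ hmin
      _ = ∑' c : ℕ × (Fin n → ℤ), ∑ r' ∈ Finset.range M,
          if P c.1 c.2 ∧ rank c = r' then volume (dyadicCube c.1 c.2) else 0 :=
          (Summable.tsum_finsetSum fun _ _ => ENNReal.summable).symm
      _ ≤ _ := by
          refine ENNReal.tsum_le_tsum fun c => ?_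
          by_cases hc : P c.1 c.2
          · simp only [hc, true_and, if_true, Finset.sum_ite_eq]
            split_ifs
            · exact le_rfl
            · exact zero_le
          · simp [hc]
  let S : Set (ℕ × (Fin n → ℤ)) := {c | P c.1 c.2 ∧ rank c = r}
  have hcover : {x | ∃ k, M ≤ Nat.count (fun i => P i (dyadicIndex i x)) k} ⊆
      ⋃ c : S, dyadicCube c.1.1 c.1.2 := by
    rintro x ⟨k, hk⟩
    have hlt : r < Nat.count (fun i => P i (dyadicIndex i x)) k :=
      (Finset.mem_range.1 hr).trans_le hk
    have hcard : ∀ hf : (Set.ofPred fun i => P i (dyadicIndex i x)).Finite,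
        r < hf.toFinset.card := fun hf => hlt.trans_le (Nat.count_le_card hf k)
    set k' := Nat.nth (fun i => P i (dyadicIndex i x)) r
    refine mem_iUnion.2 ⟨⟨(k', dyadicIndex k' x), Nat.nth_mem r hcard, ?_⟩, rfl⟩
    simp only [rank]
    rw [count_dyadicIndex_congr P (hcorner (k', dyadicIndex k' x))]
    exact Nat.count_nth hcard
  have hle := hContent_image_biUnion_dyadicCube_le hn S
    fun c _ => hContent_image_dyadicCube_le_volume hn hL hF c.1 c.2
  have hs : ∑' c : S, volume (dyadicCube c.1.1 c.1.2) = s r := by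
    rw [tsum_subtype S fun c => volume (dyadicCube c.1 c.2)]
    refine tsum_congr fun c => ?_
    simp only [Set.indicator, S, mem_ofPred_eq]
  rw [hs] at hle
  calc _ ≤ M * (ENNReal.ofReal L ^ n * s r) := mul_le_mul_right
        ((hContent_mono (by exact_mod_cast hn) (image_mono hcover)).trans hle) _
    _ = ENNReal.ofReal L ^ n * (M * s r) := by ring
    _ ≤ _ := mul_le_mul_right hsum _

end Families

/-! ### Colourings of a single dyadic grid -/

section Coloring

variable {n : ℕ}

/-- The position of `x` inside its dyadic cube of side `2⁻ᵏ`, up to a `1 / B` fraction of the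
side. -/
def dyadicPosition (B : ℕ) (hB : 0 < B) (k : ℕ) (x : Fin n → ℝ) : Fin n → Fin B := fun i =>
  ⟨⌊(B:ℝ) * Int.fract (2 ^ k * x i)⌋.toNat, by
    have hB' : (0:ℝ) < B := by exact_mod_cast hB
    have : ⌊(B:ℝ) * Int.fract (2 ^ k * x i)⌋ < B := Int.floor_lt.2 (by
      rw [Int.cast_natCast]; exact mul_lt_of_lt_one_right hB' (Int.fract_lt_one _))
    omega⟩

theorem norm_sub_le_of_dyadicPosition_eq {B : ℕ} (hB : 0 < B) {k : ℕ} {x y : Fin n → ℝ}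
    (h : dyadicIndex k x = dyadicIndex k y)
    (hp : dyadicPosition B hB k x = dyadicPosition B hB k y) : ‖y - x‖ ≤ (1 / 2) ^ k / B := by
  have hB' : (0:ℝ) < B := by exact_mod_cast hB
  have h2k : (2:ℝ) ^ k * (1 / 2) ^ k = 1 := by rw [← mul_pow]; norm_num
  rw [pi_norm_le_iff_of_nonneg (by positivity)]
  intro i
  have h1 : ⌊(2:ℝ) ^ k * x i⌋ = ⌊(2:ℝ) ^ k * y i⌋ := congrFun h i
  have h2 := congrArg Fin.val (congrFun hp i)
  simp only [dyadicPosition] at h2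
  have nn : ∀ t : ℝ, 0 ≤ ⌊(B:ℝ) * Int.fract t⌋ := fun t =>
    Int.floor_nonneg.2 (mul_nonneg hB'.le (Int.fract_nonneg t))
  have h3 : ⌊(B:ℝ) * Int.fract (2 ^ k * y i)⌋ = ⌊(B:ℝ) * Int.fract (2 ^ k * x i)⌋ := by
    have := nn (2 ^ k * x i)
    have := nn (2 ^ k * y i)
    omega
  have h4 := Int.abs_sub_lt_one_of_floor_eq_floor h3
  have e : (B:ℝ) * Int.fract (2 ^ k * y i) - B * Int.fract (2 ^ k * x i)
      = B * 2 ^ k * (y i - x i) := by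
    unfold Int.fract; rw [h1]; ring
  rw [e, abs_mul, abs_of_pos (by positivity)] at h4
  rw [Real.norm_eq_abs, Pi.sub_apply, le_div_iff₀ hB']
  calc |y i - x i| * B = (1 / 2) ^ k * (B * 2 ^ k * |y i - x i|) := by
        linear_combination (-(B:ℝ) * |y i - x i|) * h2k
    _ ≤ (1 / 2) ^ k * 1 := by gcongr
    _ = _ := mul_one _

/-- For every Lipschitz map `F` there are a set `Z` with small image and a finite colouring such
that `F` does not contract much any pair of points off `Z` with the same colour whose distance is
comparable to a small multiple of the side of a dyadic cube containing both. -/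
theorem exists_dyadic_coloring (E : Type*) [NormedAddCommGroup E] [InnerProductSpace ℝ E]
    (hn : 0 < n) {L δ : ℝ} (hL : 0 < L) (hδ : 0 < δ) :
    ∃ (A : ℕ) (C : Type) (_ : Fintype C) (c : ℝ), 4 ≤ A ∧ 0 < c ∧
      ∀ F : (Fin n → ℝ) → E, (∀ x y, ‖F x - F y‖ ≤ L * ‖x - y‖) → (∀ x, 3 ≤ ‖x‖ → F x = 0) →
        ∃ (Z : Set (Fin n → ℝ)) (col : (Fin n → ℝ) → C),
          hContent n (F '' Z) ≤ ENNReal.ofReal δ ∧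
          ∀ (k : ℕ) (x y : Fin n → ℝ), ‖x‖ ≤ 1 → ‖y‖ ≤ 1 → x ∉ Z → y ∉ Z →
            dyadicIndex k x = dyadicIndex k y → (1 / 2) ^ k / (2 * A) ≤ ‖y - x‖ →
            ‖y - x‖ ≤ (1 / 2) ^ k / A → col x = col y → c * ‖y - x‖ ≤ ‖F y - F x‖ := by
  classical
  have hd : (0:ℝ) < n := by exact_mod_cast hn
  obtain ⟨A, hA⟩ := exists_nat_ge (max 4 (2 * n * (13 * L) ^ n * 4 ^ n / (δ / 2)))
  have hA4 : 4 ≤ A := by exact_mod_cast (le_max_left _ _).trans hA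
  have hA0 : 0 < A := by omega
  have hA' : (0:ℝ) < A := by exact_mod_cast hA0
  have hAδ : 2 * n * (13 * L) ^ n / A * 4 ^ n ≤ δ / 2 := by
    have := (le_max_right _ _).trans hA
    rw [div_le_iff₀ (by positivity)] at this
    rw [div_mul_eq_mul_div, div_le_iff₀ hA']
    linarith
  let η : ℝ := L / A ^ 2
  have hη : 0 < η := by positivity
  have hηL : η ≤ 16 * L := by
    refine (div_le_self hL.le (one_le_pow₀ ?_)).trans (by linarith)
    exact_mod_cast hA0
  let ρ : ℝ := η / (16 * L)
  have hρ : 0 < ρ := by positivity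
  have hρ1 : ρ ≤ 1 := (div_le_one (by positivity)).2 hηL
  let θ : ℝ := (η / 2) ^ 2 * ρ ^ n
  have hθ : 0 < θ := by positivity
  obtain ⟨V, hV1, hVf, hV⟩ :=
    (isCompact_closedBall (0 : Fin n → ℝ) 1).finite_cover_balls hρ
  let C₀ : ℝ≥0∞ := hVf.toFinset.card * (ENNReal.ofReal θ⁻¹ * ENNReal.ofReal (L ^ 2 * 8 ^ n))
  obtain ⟨M, hM0, hM⟩ : ∃ M : ℕ, 0 < M ∧
      ENNReal.ofReal L ^ n * C₀ ≤ M * ENNReal.ofReal (δ / 2) := by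
    have hfin : ENNReal.ofReal L ^ n * C₀ ≠ ⊤ := by
      refine ENNReal.mul_ne_top (ENNReal.pow_ne_top ENNReal.ofReal_ne_top) ?_
      exact ENNReal.mul_ne_top (ENNReal.natCast_ne_top _)
        (ENNReal.mul_ne_top ENNReal.ofReal_ne_top ENNReal.ofReal_ne_top)
    obtain ⟨M, hM0, hM⟩ := ENNReal.exists_nat_pos_mul_gt (a := ENNReal.ofReal (δ / 2))
      (by simpa using hδ) hfin
    exact ⟨M, hM0, hM.le⟩
  refine ⟨A, Fin M → Fin n → Fin (4 * A), inferInstance, η, hA4, hη, fun F hF hs => ?_⟩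
  let P : ℕ → (Fin n → ℤ) → Prop := IsOscillating F θ V
  let R : ℕ → (Fin n → ℤ) → Prop := fun k j => ¬ P k j ∧ ∃ x ∈ dyadicCube k j,
    ∃ y ∈ dyadicCube k j, (1 / 2) ^ k / (2 * A) ≤ ‖y - x‖ ∧ ‖y - x‖ ≤ (1 / 2) ^ k / A ∧
      ‖F y - F x‖ ≤ η * (1 / 2) ^ k
  let Z₁ : Set (Fin n → ℝ) := {x | ∃ k, M ≤ Nat.count (fun i => P i (dyadicIndex i x)) k}
  let Z₂ : Set (Fin n → ℝ) := {x | ‖x‖ ≤ 1 ∧ ∃ k, R k (dyadicIndex k x)}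
  have hZ₁ : hContent n (F '' Z₁) ≤ ENNReal.ofReal (δ / 2) := by
    have h1 := hContent_image_count_le hn hL.le hF P hM0
    have h2 := tsum_volume_isOscillating_le hF hs (V := hVf.toFinset)
      (fun v hv => by simpa using hV1 (hVf.mem_toFinset.1 hv)) hθ
    rw [hVf.coe_toFinset] at h2
    have h3 := (h1.trans (mul_le_mul_right h2 _)).trans hM
    rwa [ENNReal.mul_le_mul_iff_right (by exact_mod_cast hM0.ne') (ENNReal.natCast_ne_top M)] at h3
  have hZ₂ : hContent n (F '' Z₂) ≤ ENNReal.ofReal (δ / 2) := by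
    refine (hContent_image_exists_dyadicCube_le hn R
      (κ := ENNReal.ofReal (2 * n * (13 * L) ^ n / A)) ?_).trans ?_
    · rintro k j ⟨hP, x, hx, y, hy, h1, h2, h3⟩
      refine hContent_image_dyadicCube_le hn hL hF hA0 (by positivity) le_rfl (fun a u ha hau => ?_)
        hx hy h1 h2 h3
      exact norm_secondDiff_le_of_not_isOscillating hL hF hη hρ hρ1
        (mul_div_cancel₀ _ (by positivity)).le le_rfl hV hP ha hau
    · rw [← ENNReal.ofReal_mul (by positivity)]
      exact ENNReal.ofReal_le_ofReal hAδ
  refine ⟨Z₁ ∪ Z₂, fun x r => dyadicPosition (4 * A) (by omega)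
    (Nat.nth (fun i => P i (dyadicIndex i x)) r) x, ?_, ?_⟩
  · rw [image_union]
    refine (hContent_union_le hd _ _).trans ((add_le_add hZ₁ hZ₂).trans_eq ?_)
    rw [← ENNReal.ofReal_add (by positivity) (by positivity), add_halves]
  · intro k x y hx1 hy1 hxZ hyZ hxy h1 h2 hcol
    have hk : (0:ℝ) < (1 / 2) ^ k := by positivity
    have hPn : ¬ P k (dyadicIndex k x) := by
      intro hP
      have hlt : Nat.count (fun i => P i (dyadicIndex i x)) k < M := by
        by_contra! h
        exact hxZ (Or.inl ⟨k, h⟩)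
      have hcolr := congrFun hcol ⟨_, hlt⟩
      have hx' : Nat.nth (fun i => P i (dyadicIndex i x))
          (Nat.count (fun i => P i (dyadicIndex i x)) k) = k := Nat.nth_count hP
      have hy' : Nat.nth (fun i => P i (dyadicIndex i y))
          (Nat.count (fun i => P i (dyadicIndex i x)) k) = k := by
        rw [count_dyadicIndex_congr P hxy]
        exact Nat.nth_count (p := fun i => P i (dyadicIndex i y)) (hxy ▸ hP)
      simp only [hx', hy'] at hcolr
      have h3 := h1.trans (norm_sub_le_of_dyadicPosition_eq _ hxy hcolr)
      push_cast at h3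
      rw [div_le_div_iff_of_pos_left hk (by positivity) (by positivity)] at h3
      linarith
    have hRn : ¬ R k (dyadicIndex k x) := fun hR => hxZ (Or.inr ⟨hx1, k, hR⟩)
    have h4 : η * (1 / 2) ^ k < ‖F y - F x‖ := by
      by_contra! h
      exact hRn ⟨hPn, x, rfl, y, hxy.symm, h1, h2, h⟩
    refine le_trans ?_ h4.le
    gcongr
    refine h2.trans (div_le_self hk.le ?_)
    exact_mod_cast hA0

end Coloring

/-! ### Extension and the one-third trick -/

section Decomposition

variable {n : ℕ}

theorem hContent_image_isometry_le {X Y : Type*} [PseudoEMetricSpace X] [PseudoEMetricSpace Y]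
    {e : X → Y} (he : Isometry e) (d : ℝ) (S : Set X) : hContent d (e '' S) ≤ hContent d S := by
  refine le_iInf₂ fun U hU => iInf₂_le_of_le (fun i => e '' U i) ?_ ?_
  · rw [← image_iUnion]
    exact image_mono hU
  · exact (tsum_congr fun i => congrArg (· ^ d) (he.ediam_image (U i))).le

/-- A Lipschitz function on the unit cube extends, after subtracting its value at the origin, to a
Lipschitz function on the whole space vanishing outside the ball of radius two. -/
theorem exists_lipschitz_extension (n : ℕ) (E : Type*) [NormedAddCommGroup E] [NormedSpace ℝ E]
    [FiniteDimensional ℝ E] (L : ℝ≥0) :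
    ∃ L₁ : ℝ, 0 < L₁ ∧ ∀ f : EuclideanSpace ℝ (Fin n) → E, LipschitzOnWith L f (unitCube n) →
      ∃ G : (Fin n → ℝ) → E, (∀ x y, ‖G x - G y‖ ≤ L₁ * ‖x - y‖) ∧ (∀ x, 2 ≤ ‖x‖ → G x = 0) ∧
        ∀ x ∈ unitCube n, G (WithLp.ofLp x) = f x - f 0 := by
  classical
  obtain ⟨K, hK⟩ : ∃ K : ℝ≥0, LipschitzWith K (WithLp.toLp 2 : (Fin n → ℝ) → EuclideanSpace ℝ (Fin n)) :=
    ⟨_, PiLp.lipschitzWith_toLp 2 _⟩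
  set M : ℝ≥0 := L * K with hM
  refine ⟨(lipschitzExtensionConstant E * M : ℝ≥0) + 1, by positivity, fun f hf => ?_⟩
  set Q : Set (Fin n → ℝ) := {x | WithLp.toLp 2 x ∈ unitCube n} with hQ
  set g : (Fin n → ℝ) → E := fun x => if x ∈ Q then f (WithLp.toLp 2 x) - f 0 else 0 with hg
  have hQ1 : ∀ x ∈ Q, ‖x‖ ≤ 1 := fun x hx => by
    refine (pi_norm_le_iff_of_nonneg zero_le_one).2 fun i => ?_
    have := hx i
    rw [Real.norm_eq_abs, abs_le]
    simp only [mem_Icc] at this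
    constructor <;> linarith [this.1, this.2]
  have h0 : (0 : Fin n → ℝ) ∈ Q := fun i => by simp
  have hfL : ∀ x ∈ Q, ∀ y ∈ Q, ‖f (WithLp.toLp 2 x) - f (WithLp.toLp 2 y)‖ ≤ M * ‖x - y‖ := by
    intro x hx y hy
    have h1 := hf.dist_le_mul _ hx _ hy
    have h2 := hK.dist_le_mul x y
    rw [dist_eq_norm] at h1
    rw [dist_eq_norm x y] at h2
    calc _ ≤ _ := h1
      _ ≤ L * (K * ‖x - y‖) := by gcongr
      _ = _ := by rw [hM]; push_cast; ring
  have hgL : LipschitzOnWith M g (Q ∪ {x | 2 ≤ ‖x‖}) := by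
    have hQ2 : ∀ x, 2 ≤ ‖x‖ → x ∉ Q := fun x hx h => by linarith [hQ1 x h]
    have hmix : ∀ x ∈ Q, ∀ y, 2 ≤ ‖y‖ → ‖f (WithLp.toLp 2 x) - f 0‖ ≤ M * ‖x - y‖ := by
      intro x hx y hy
      have h1 := hfL x hx 0 h0
      rw [sub_zero, WithLp.toLp_zero] at h1
      refine h1.trans ?_
      have h2 := hQ1 x hx
      have h3 := norm_sub_norm_le y x
      rw [norm_sub_rev] at h3
      gcongr
      linarith
    refine LipschitzOnWith.of_dist_le_mul fun x hx y hy => ?_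
    rw [dist_eq_norm, dist_eq_norm]
    rcases hx with hx | hx <;> rcases hy with hy | hy
    · simpa [hg, hx, hy] using hfL x hx y hy
    · simpa [hg, hx, hQ2 y hy] using hmix x hx y hy
    · rw [norm_sub_rev, norm_sub_rev x y]
      simpa [hg, hy, hQ2 x hx] using hmix y hy x hx
    · simp only [hg, hQ2 x hx, hQ2 y hy, if_false, sub_self, norm_zero]
      positivity
  obtain ⟨G, hG, hGg⟩ := hgL.extend_finite_dimension
  refine ⟨G, fun x y => ?_, fun x hx => ?_, fun x hx => ?_⟩
  · have := hG.dist_le_mul x y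
    rw [dist_eq_norm, dist_eq_norm] at this
    refine this.trans ?_
    gcongr
    linarith
  · rw [← hGg (Or.inr hx)]
    have : x ∉ Q := fun h => by linarith [hQ1 x h]
    simp [hg, this]
  · have hx' : WithLp.ofLp x ∈ Q := hx
    rw [← hGg (Or.inl hx')]
    simp [hx', hg]

/-- Of two nearby reals, either they have the same integer part, or they do after a translation
by `2 ^ k / 3`. -/
theorem floor_eq_or_floor_sub_eq (k : ℕ) {s t : ℝ} (h : |s - t| < 1 / 3) :
    ⌊s⌋ = ⌊t⌋ ∨ ⌊s - 2 ^ k * (1 / 3)⌋ = ⌊t - 2 ^ k * (1 / 3)⌋ := by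
  wlog hst : s ≤ t generalizing s t
  · rw [abs_sub_comm] at h
    rcases this h (le_of_not_ge hst) with h | h
    · exact Or.inl h.symm
    · exact Or.inr h.symm
  have hd : t - s < 1 / 3 := by
    rw [abs_sub_comm] at h
    exact (le_abs_self _).trans_lt h
  by_cases hfl : ⌊s⌋ = ⌊t⌋
  · exact Or.inl hfl
  right
  have h1 : ⌊s⌋ < ⌊t⌋ := lt_of_le_of_ne (Int.floor_mono hst) hfl
  have hs : s < ⌊t⌋ := by
    by_contra! hc
    exact absurd (Int.le_floor.2 hc) (not_le.2 h1)
  have ht := Int.floor_le t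
  obtain ⟨q, r, hq, hr⟩ : ∃ (q : ℤ) (r : ℤ), (2 : ℤ) ^ k = 3 * q + r ∧ (r = 1 ∨ r = 2) := by
    refine ⟨2 ^ k / 3, 2 ^ k % 3, (Int.mul_ediv_add_emod _ _).symm, ?_⟩
    have h3 : ¬ (3 : ℤ) ∣ 2 ^ k := fun h => by
      have := Int.prime_three.dvd_of_dvd_pow h
      omega
    omega
  have hqr : (2 : ℝ) ^ k = 3 * q + r := by exact_mod_cast hq
  have hr' : (1 : ℝ) ≤ r ∧ (r : ℝ) ≤ 2 := by rcases hr with rfl | rfl <;> norm_num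
  have e1 : ⌊s - 2 ^ k * (1 / 3)⌋ = ⌊t⌋ - q - 1 := by
    rw [Int.floor_eq_iff]
    push_cast
    constructor <;> linarith [hr'.1, hr'.2]
  have e2 : ⌊t - 2 ^ k * (1 / 3)⌋ = ⌊t⌋ - q - 1 := by
    rw [Int.floor_eq_iff]
    push_cast
    constructor <;> linarith [hr'.1, hr'.2]
  rw [e1, e2]

/-- The translation by one third in the coordinates selected by `τ`. -/
def thirdShift (τ : Fin n → Bool) : Fin n → ℝ := fun i => if τ i then 1 / 3 else 0

theorem norm_thirdShift_le (τ : Fin n → Bool) : ‖thirdShift τ‖ ≤ 1 / 3 := by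
  refine (pi_norm_le_iff_of_nonneg (by norm_num)).2 fun i => ?_
  unfold thirdShift
  split_ifs <;> norm_num

theorem exists_dyadicIndex_sub_thirdShift_eq (k : ℕ) {x y : Fin n → ℝ}
    (h : 2 ^ k * ‖y - x‖ < 1 / 3) :
    ∃ τ, dyadicIndex k (x - thirdShift τ) = dyadicIndex k (y - thirdShift τ) := by
  have key : ∀ i, ∃ b : Bool, ⌊(2:ℝ) ^ k * (x i - if b then 1 / 3 else 0)⌋ =
      ⌊(2:ℝ) ^ k * (y i - if b then 1 / 3 else 0)⌋ := by
    intro i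
    have h1 : |2 ^ k * x i - 2 ^ k * y i| < 1 / 3 := by
      rw [← mul_sub, abs_mul, abs_of_pos (by positivity), abs_sub_comm]
      refine lt_of_le_of_lt ?_ h
      gcongr
      exact norm_le_pi_norm (y - x) i
    rcases floor_eq_or_floor_sub_eq k h1 with h2 | h2
    · exact ⟨false, by simpa using h2⟩
    · exact ⟨true, by simpa only [if_true, mul_sub] using h2⟩
  choose τ hτ using key
  exact ⟨τ, funext hτ⟩

end Decomposition

/-- Jones-type decomposition, quantitative. For all `n, m ≥ 1`, `L > 0`,
`δ > 0` there are `N ≥ 1` and `L' ≥ 1` depending only on the data such that every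
`L`-Lipschitz `f : [0,1]^n → ℝ^m` admits a decomposition `[0,1]^n = Z ∪ K_1 ∪ ⋯ ∪ K_N`
with `h^n(f(Z)) < δ` and `f` biLipschitz with constant `L'` on each `K_i`. -/
theorem statement1 (n m : ℕ) (hn : 0 < n) (hm : 0 < m) (L δ : ℝ) (hL : 0 < L) (hδ : 0 < δ) :
    ∃ (N : ℕ) (L' : ℝ), 0 < N ∧ 1 ≤ L' ∧
      ∀ f : EuclideanSpace ℝ (Fin n) → EuclideanSpace ℝ (Fin m),
        LipschitzOnWith L.toNNReal f (unitCube n) →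
        ∃ (Z : Set (EuclideanSpace ℝ (Fin n))) (K : Fin N → Set (EuclideanSpace ℝ (Fin n))),
          Z ⊆ unitCube n ∧ (∀ i, K i ⊆ unitCube n) ∧
          Z ∪ (⋃ i, K i) = unitCube n ∧
          hContent n (f '' Z) < ENNReal.ofReal δ ∧
          ∀ i, BiLipschitzWithOn L' f (K i) := by
  classical
  have hd : (0:ℝ) < n := by exact_mod_cast hn
  obtain ⟨L₁, hL₁, hext⟩ := exists_lipschitz_extension n (EuclideanSpace ℝ (Fin m)) L.toNNReal
  obtain ⟨M, hM⟩ :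
      ∃ M : ℝ≥0, LipschitzWith M (WithLp.toLp 2 : (Fin n → ℝ) → EuclideanSpace ℝ (Fin n)) :=
    ⟨_, PiLp.lipschitzWith_toLp 2 _⟩
  set η : ℝ := δ / (2 * Fintype.card (Fin n → Bool)) with hη
  have hcard : (0:ℝ) < Fintype.card (Fin n → Bool) := by exact_mod_cast Fintype.card_pos
  have hη0 : 0 < η := by positivity
  obtain ⟨A, C, _, c, hA, hc, hcol⟩ :=
    exists_dyadic_coloring (EuclideanSpace ℝ (Fin m)) hn hL₁ hη0
  have hA' : (4:ℝ) ≤ A := by exact_mod_cast hA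
  set Col := ((Fin n → Bool) → C) × (Fin n → Fin (A + 1)) with hCol
  have hL' : (0:ℝ) < M / c + L + 1 := by positivity
  refine ⟨Fintype.card Col + 1, M / c + L + 1, by omega, by
    have : (0:ℝ) ≤ M / c := by positivity
    linarith, fun f hf => ?_⟩
  obtain ⟨G, hGL, hG2, hGf⟩ := hext f hf
  have hF := fun τ : Fin n → Bool => hcol (fun x => G (x + thirdShift τ))
    (fun x y => by simpa using hGL (x + thirdShift τ) (y + thirdShift τ))
    (fun x hx => hG2 _ (by
      have h1 := norm_thirdShift_le τ
      have h2 := norm_sub_norm_le x (-thirdShift τ)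
      rw [norm_neg, sub_neg_eq_add] at h2
      linarith))
  choose W col hW hcolW using hF
  set base : EuclideanSpace ℝ (Fin n) → Fin n → Fin (A + 1) := fun x i =>
    Fin.ofNat (A + 1) ⌊A * x i⌋₊ with hbase
  set color : EuclideanSpace ℝ (Fin n) → Col := fun x =>
    (fun τ => col τ (WithLp.ofLp x - thirdShift τ), base x) with hcolor
  set Z : Set (EuclideanSpace ℝ (Fin n)) :=
    {x | x ∈ unitCube n ∧ ∃ τ, WithLp.ofLp x - thirdShift τ ∈ W τ} with hZ
  refine ⟨Z, fun i => {x | x ∈ unitCube n ∧ x ∉ Z ∧ (Fintype.equivFin Col (color x)).castSucc = i},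
    fun x hx => hx.1, fun i x hx => hx.1, ?_, ?_, ?_⟩
  · refine Subset.antisymm (union_subset (fun x hx => hx.1) (iUnion_subset fun i x hx => hx.1)) ?_
    intro x hx
    by_cases hxZ : x ∈ Z
    · exact Or.inl hxZ
    · exact Or.inr (mem_iUnion.2 ⟨_, hx, hxZ, rfl⟩)
  · have hsub : f '' Z ⊆
        (fun v => v + f 0) '' ⋃ τ, (fun x => G (x + thirdShift τ)) '' W τ := by
      rintro _ ⟨x, ⟨hx, τ, hτ⟩, rfl⟩
      refine ⟨f x - f 0, mem_iUnion.2 ⟨τ, _, hτ, ?_⟩, sub_add_cancel _ _⟩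
      simp only [sub_add_cancel]
      exact hGf x hx
    calc hContent n (f '' Z) ≤ _ := hContent_mono hd hsub
      _ ≤ _ := hContent_image_isometry_le (isometry_add_right _) _ _
      _ ≤ _ := hContent_iUnion_le hd _
      _ ≤ ∑' _ : Fin n → Bool, ENNReal.ofReal η := ENNReal.tsum_le_tsum hW
      _ = ENNReal.ofReal (Fintype.card (Fin n → Bool) * η) := by
        rw [tsum_fintype, Finset.sum_const, Finset.card_univ, nsmul_eq_mul,
          ENNReal.ofReal_mul hcard.le, ENNReal.ofReal_natCast]
      _ < ENNReal.ofReal δ := by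
        rw [ENNReal.ofReal_lt_ofReal_iff hδ]
        have : Fintype.card (Fin n → Bool) * η = δ / 2 := by rw [hη]; field_simp
        rw [this]
        linarith
  · rintro i x ⟨hx, hxZ, hxi⟩ y ⟨hy, hyZ, hyi⟩
    have hxy : color x = color y :=
      (Fintype.equivFin Col).injective (Fin.castSucc_injective _ (hxi.trans hyi.symm))
    have hupper : dist (f x) (f y) ≤ (M / c + L + 1) * dist x y := by
      have h1 := hf.dist_le_mul x hx y hy
      rw [Real.coe_toNNReal _ hL.le] at h1
      refine h1.trans ?_
      gcongr
      have : (0:ℝ) ≤ M / c := by positivity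
      linarith
    refine ⟨?_, hupper⟩
    set x' := WithLp.ofLp x with hx'
    set y' := WithLp.ofLp y with hy'
    rcases eq_or_ne x y with rfl | hne
    · simp
    have hr : 0 < ‖y' - x'‖ := norm_pos_iff.2 (sub_ne_zero.2 fun h =>
      hne ((WithLp.ofLp_injective 2) h.symm))
    have hlt : A * ‖y' - x'‖ < 1 := by
      rw [mul_comm, ← lt_div_iff₀ (by linarith)]
      refine (pi_norm_lt_iff (by positivity)).2 fun i => ?_
      have habs : |y' i - x' i| * A = |A * y i - A * x i| := by
        rw [← mul_sub, abs_mul, Nat.abs_cast, mul_comm]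
      rw [lt_div_iff₀ (by linarith), Real.norm_eq_abs, Pi.sub_apply, habs]
      have hle : ∀ z ∈ unitCube n, ⌊A * z i⌋₊ < A + 1 := fun z hz => by
        refine Nat.lt_succ_of_le (Nat.floor_le_of_le ?_)
        have := (hz i).2
        nlinarith
      have hnn : ∀ z ∈ unitCube n, 0 ≤ A * z i := fun z hz =>
        mul_nonneg (by linarith) (hz i).1
      have hb := congrArg Fin.val (congrFun (congrArg Prod.snd hxy) i)
      simp only [hcolor, hbase, Fin.val_ofNat, Nat.mod_eq_of_lt (hle x hx),
        Nat.mod_eq_of_lt (hle y hy)] at hb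
      have a1 := Nat.floor_le (hnn x hx)
      have a2 := Nat.lt_floor_add_one (A * x i)
      have b1 := Nat.floor_le (hnn y hy)
      have b2 := Nat.lt_floor_add_one (A * y i)
      rw [hb] at a1 a2
      rw [abs_lt]
      constructor <;> linarith
    obtain ⟨k, hk1, hk2⟩ := exists_nat_pow_near_of_lt_one (y := (1 / 2 : ℝ))
      (mul_pos (by linarith) hr) hlt.le (by norm_num) (by norm_num)
    have h2k : (2:ℝ) ^ k * (1 / 2) ^ k = 1 := by rw [← mul_pow]; norm_num
    obtain ⟨τ, hτ⟩ := exists_dyadicIndex_sub_thirdShift_eq k (x := x') (y := y') (by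
      have h1 : 2 ^ k * (A * ‖y' - x'‖) ≤ 1 := by
        rw [← h2k]
        gcongr
      have h2 : 0 < 2 ^ k * ‖y' - x'‖ := by positivity
      nlinarith)
    have hcube : ∀ z ∈ unitCube n, ‖WithLp.ofLp z - thirdShift τ‖ ≤ 1 := fun z hz => by
      refine (pi_norm_le_iff_of_nonneg zero_le_one).2 fun i => ?_
      have h1 := hz i
      rw [mem_Icc] at h1
      rw [Real.norm_eq_abs, abs_le, Pi.sub_apply]
      unfold thirdShift
      split_ifs <;> constructor <;> linarith [h1.1, h1.2]
    have hnot : ∀ z ∈ unitCube n, z ∉ Z → WithLp.ofLp z - thirdShift τ ∉ W τ :=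
      fun z hz hzZ h => hzZ ⟨hz, τ, h⟩
    have hlow := hcolW τ k (x' - thirdShift τ) (y' - thirdShift τ) (hcube x hx) (hcube y hy)
      (hnot x hx hxZ) (hnot y hy hyZ) hτ
      (by
        rw [sub_sub_sub_cancel_right, div_le_iff₀ (by positivity)]
        rw [pow_succ] at hk1
        linarith)
      (by
        rw [sub_sub_sub_cancel_right, le_div_iff₀ (by linarith)]
        linarith)
      (congrFun (congrArg Prod.fst hxy) τ)
    simp only [sub_sub_sub_cancel_right, sub_add_cancel] at hlow
    rw [hGf x hx, hGf y hy, sub_sub_sub_cancel_right, norm_sub_rev, norm_sub_rev (f y),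
      ← dist_eq_norm, ← dist_eq_norm] at hlow
    have hdist : dist x y ≤ M * dist x' y' := hM.dist_le_mul x' y'
    rw [inv_mul_le_iff₀ hL']
    calc dist x y ≤ M / c * (c * dist x' y') := by
          refine hdist.trans_eq ?_
          field_simp
      _ ≤ M / c * dist (f x) (f y) := by gcongr
      _ ≤ _ := by
        gcongr
        linarith
end
end

section
/- Let k be a positive integer, let X be a metric space, let F : [0,1]^k → X be a Lipschitz map, and let δ > 0. Then there exist a positive integer n and sets G, F_1, …, F_n ⊆ [0,1]^k with [0,1]^k = G ∪ F_1 ∪ ⋯ ∪ F_n, such that the Hausdorff k-content of F(G) is less than δ and F is biLipschitz on each F_j. -/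
open MeasureTheory Metric Set Filter
open scoped ENNReal NNReal

noncomputable section

theorem hContent_le_hausdorffMeasure {X : Type*} [EMetricSpace X] [MeasurableSpace X]
    [BorelSpace X] {d : ℝ} (hd : 0 < d) (S : Set X) : hContent d S ≤ μH[d] S := by
  rw [Measure.hausdorffMeasure_apply]
  refine le_iSup₂_of_le 1 one_pos (le_iInf₂ fun t ht ↦ le_iInf fun _ ↦ ?_)
  refine (iInf₂_le t ht).trans (ENNReal.tsum_le_tsum fun n ↦ ?_)
  rcases (t n).eq_empty_or_nonempty with h | h
  · rw [h]
    change ediam (∅ : Set X) ^ d ≤ _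
    simp [hd]
  · exact le_iSup_of_le h le_rfl

theorem LipschitzWith.abs_sub_le_of_abs_deriv_le {g : ℝ → ℝ} {K : ℝ≥0} (hg : LipschitzWith K g)
    {A : Set ℝ} (hA : MeasurableSet A) {ε : ℝ} (hε : 0 ≤ ε) (hgA : ∀ t ∈ A, |deriv g t| ≤ ε)
    {a b : ℝ} (hab : a ≤ b) :
    |g b - g a| ≤ ε * (b - a) + K * volume.real (Aᶜ ∩ Icc a b) := by
  have hac : AbsolutelyContinuousOnInterval g a b :=
    hg.lipschitzOnWith.absolutelyContinuousOnInterval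
  have hfin : volume (Aᶜ ∩ Ioc a b) ≠ ∞ :=
    ((measure_mono inter_subset_right).trans_lt measure_Ioc_lt_top).ne
  have hint : IntervalIntegrable (fun t ↦ ε + Aᶜ.indicator (fun _ ↦ (K : ℝ)) t) volume a b := by
    refine intervalIntegrable_const.add ?_
    rw [intervalIntegrable_iff_integrableOn_Ioc_of_le hab]
    exact (integrable_const _).indicator hA.compl
  calc |g b - g a| = |∫ t in a..b, deriv g t| := by rw [hac.integral_deriv_eq_sub]
    _ ≤ ∫ t in a..b, |deriv g t| := intervalIntegral.abs_integral_le_integral_abs hab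
    _ ≤ ∫ t in a..b, (ε + Aᶜ.indicator (fun _ ↦ (K : ℝ)) t) := by
      refine intervalIntegral.integral_mono_on hab hac.intervalIntegrable_deriv.abs hint
        fun t _ ↦ ?_
      by_cases ht : t ∈ A
      · simpa [ht] using hgA t ht
      · have := norm_deriv_le_of_lipschitz (x₀ := t) hg
        rw [Real.norm_eq_abs] at this
        simp only [mem_compl_iff, ht, not_false_eq_true, indicator_of_mem]
        linarith
    _ = ε * (b - a) + K * volume.real (Aᶜ ∩ Ioc a b) := by
      rw [intervalIntegral.integral_of_le hab, integral_add (integrable_const _)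
        ((integrable_const _).indicator hA.compl), integral_indicator hA.compl]
      simp [Measure.restrict_restrict hA.compl, measureReal_def, hab, mul_comm]
    _ ≤ _ := by
      gcongr
      · exact ((measure_mono inter_subset_right).trans_lt measure_Icc_lt_top).ne
      · exact Ioc_subset_Icc_self

section

variable {X : Type*} [PseudoMetricSpace X]

theorem ae_exists_dist_le_of_abs_deriv_dist_le {g : ℝ → X} {K : ℝ≥0} (hg : LipschitzWith K g)
    {ι : Type*} {p : ι → X}
    (hp : ∀ s t c, (∀ i, |dist (g s) (p i) - dist (g t) (p i)| ≤ c) → dist (g s) (g t) ≤ c)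
    {A : Set ℝ} (hA : MeasurableSet A) {ε : ℝ} (hε : 0 < ε)
    (hgA : ∀ t ∈ A, ∀ i, |deriv (fun s ↦ dist (g s) (p i)) t| ≤ ε) :
    ∀ᵐ t, t ∈ A → ∃ m : ℕ, ∀ h : ℝ, |h| ≤ 1 / ((m : ℝ) + 1) →
      dist (g (t + h)) (g t) ≤ 2 * ε * |h| := by
  have hcoord (i : ι) : LipschitzWith K (fun s ↦ dist (g s) (p i)) := by
    simpa [Function.comp_def] using (LipschitzWith.dist_left (p i)).comp hg
  have key (a b : ℝ) (hab : a ≤ b) :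
      dist (g b) (g a) ≤ ε * (b - a) + K * volume.real (Aᶜ ∩ Icc a b) :=
    hp b a _ fun i ↦ (hcoord i).abs_sub_le_of_abs_deriv_le hA hε.le (fun t ht ↦ hgA t ht i) hab
  filter_upwards [Besicovitch.ae_tendsto_measure_inter_div_of_measurableSet volume hA.compl]
    with t ht htA
  have hpos : 0 < ε / (2 * ((K : ℝ) + 1)) := by positivity
  simp only [mem_compl_iff, htA, not_true_eq_false, not_false_eq_true, indicator_of_notMem] at ht
  have hev := ht.eventually_le_const (ENNReal.ofReal_pos.2 hpos)
  obtain ⟨r, hr, hrt⟩ := mem_nhdsGT_iff_exists_Ioo_subset.1 hev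
  obtain ⟨m, hm⟩ := exists_nat_one_div_lt (show (0 : ℝ) < r from hr)
  refine ⟨m, fun h hh ↦ ?_⟩
  rcases eq_or_ne h 0 with rfl | h0
  · simp
  have habs : 0 < |h| := abs_pos.2 h0
  have hball : volume.real (Aᶜ ∩ closedBall t |h|) ≤ ε / (2 * ((K : ℝ) + 1)) * (2 * |h|) := by
    have h1 : volume (Aᶜ ∩ closedBall t |h|) / volume (closedBall t |h|) ≤ _ :=
      hrt ⟨habs, hh.trans_lt hm⟩
    rw [Real.volume_closedBall, ENNReal.div_le_iff (by simpa using habs) ENNReal.ofReal_ne_top,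
      ← ENNReal.ofReal_mul hpos.le] at h1
    exact ENNReal.toReal_le_of_le_ofReal (by positivity) h1
  have hsmall (a b : ℝ) (hab : a ≤ b) (hba : b - a = |h|) (hsub : Icc a b ⊆ closedBall t |h|) :
      dist (g b) (g a) ≤ 2 * ε * |h| := by
    have h2 : volume.real (Aᶜ ∩ Icc a b) ≤ volume.real (Aᶜ ∩ closedBall t |h|) :=
      measureReal_mono (inter_subset_inter_right _ hsub)
        ((measure_mono inter_subset_right).trans_lt measure_closedBall_lt_top).ne
    have h3 : (K : ℝ) * (ε / (2 * ((K : ℝ) + 1)) * (2 * |h|)) ≤ ε * |h| := by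
      have : (K : ℝ) * (ε / (2 * ((K : ℝ) + 1)) * (2 * |h|))
          = (K / ((K : ℝ) + 1)) * (ε * |h|) := by field_simp
      rw [this]
      refine mul_le_of_le_one_left (by positivity) ?_
      rw [div_le_one (by positivity)]
      linarith
    have h4 := mul_le_mul_of_nonneg_left (h2.trans hball) K.coe_nonneg
    have h5 := key a b hab
    rw [hba] at h5
    linarith
  rcases le_total 0 h with hs | hs
  · refine hsmall t (t + h) (by linarith) (by rw [abs_of_nonneg hs]; ring) ?_
    rw [Real.closedBall_eq_Icc, abs_of_nonneg hs]
    exact Icc_subset_Icc (by linarith) le_rfl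
  · rw [dist_comm]
    refine hsmall (t + h) t (by linarith) (by rw [abs_of_nonpos hs]; ring) ?_
    rw [Real.closedBall_eq_Icc, abs_of_nonpos hs]
    exact Icc_subset_Icc (by linarith) (by linarith)

end

theorem hausdorffMeasure_image_le_of_dist_le {X E : Type*} [MetricSpace X] [MeasurableSpace X]
    [BorelSpace X] [MetricSpace E] [MeasurableSpace E] [BorelSpace E] {F : E → X} {T : E → E}
    {C : ℝ≥0} {S : Set E}
    (h : ∀ x ∈ S, ∀ y ∈ S, dist (F x) (F y) ≤ C * dist (T x) (T y)) {d : ℝ} (hd : 0 ≤ d) :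
    μH[d] (F '' S) ≤ (C : ℝ≥0∞) ^ d * μH[d] (T '' S) := by
  rcases S.eq_empty_or_nonempty with rfl | hS
  · simp
  have : Nonempty E := ⟨hS.some⟩
  have hmem (y : E) (hy : y ∈ T '' S) := Function.invFunOn_mem hy
  have heq (y : E) (hy : y ∈ T '' S) := Function.invFunOn_eq hy
  have hG : LipschitzOnWith C (F ∘ Function.invFunOn T S) (T '' S) := by
    refine LipschitzOnWith.of_dist_le_mul fun x hx y hy ↦ ?_
    have := h _ (hmem x hx) _ (hmem y hy)
    rwa [heq x hx, heq y hy] at this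
  refine le_trans (measure_mono ?_) (hG.hausdorffMeasure_image_le hd)
  rintro _ ⟨x, hx, rfl⟩
  refine ⟨T x, mem_image_of_mem T hx, dist_le_zero.1 ?_⟩
  have := h _ (hmem _ (mem_image_of_mem T hx)) x hx
  rwa [heq _ (mem_image_of_mem T hx), dist_self, mul_zero] at this

section SlowSet

variable {X : Type*} {E : Type*} [NormedAddCommGroup E] [InnerProductSpace ℝ E]

/-- The points from which `F` moves at speed at most `ε` in the direction `v`, up to time
`1 / (m + 1)`. -/
def slowSet [PseudoMetricSpace X] (F : E → X) (v : E) (ε : ℝ) (m : ℕ) : Set E :=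
  {x | ∀ t : ℝ, |t| ≤ 1 / ((m : ℝ) + 1) → dist (F (x + t • v)) (F x) ≤ ε * |t|}

theorem isClosed_slowSet [PseudoMetricSpace X] {F : E → X} (hF : Continuous F) (v : E) (ε : ℝ)
    (m : ℕ) : IsClosed (slowSet F v ε m) := by
  simp only [slowSet, ofPred_forall]
  exact isClosed_iInter fun t ↦ isClosed_iInter fun _ ↦
    isClosed_le (by fun_prop) continuous_const

theorem ae_exists_mem_slowSet [PseudoMetricSpace X] [FiniteDimensional ℝ E] [MeasurableSpace E]
    [BorelSpace E] (μ : Measure E) [μ.IsAddHaarMeasure] {F : E → X} {K : ℝ≥0}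
    (hF : LipschitzWith K F) {ι : Type*} [Countable ι] {p : ι → X}
    (hp : ∀ x y c, (∀ i, |dist (F x) (p i) - dist (F y) (p i)| ≤ c) → dist (F x) (F y) ≤ c)
    {v : E} (hv : ‖v‖ = 1) {ε : ℝ} (hε : 0 < ε) :
    ∀ᵐ x ∂μ, (∀ i, |lineDeriv ℝ (fun y ↦ dist (F y) (p i)) x v| ≤ ε) →
      ∃ m, x ∈ slowSet F v (2 * ε) m := by
  have hcont (i : ι) : Continuous fun y ↦ dist (F y) (p i) := hF.continuous.dist continuous_const
  set A : Set E := {x | ∀ i, |lineDeriv ℝ (fun y ↦ dist (F y) (p i)) x v| ≤ ε} with hAdef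
  have hA : MeasurableSet A := by
    simp only [hAdef, ofPred_forall]
    exact MeasurableSet.iInter fun i ↦
      measurableSet_le ((measurable_lineDeriv (hcont i)).abs) measurable_const
  have hS : MeasurableSet (⋃ m, slowSet F v (2 * ε) m) :=
    MeasurableSet.iUnion fun m ↦ (isClosed_slowSet hF.continuous v _ m).measurableSet
  have hmem : ∀ᵐ x ∂μ, x ∈ Aᶜ ∪ ⋃ m, slowSet F v (2 * ε) m := by
    refine ae_mem_of_ae_add_linearMap_mem (LinearMap.toSpanSingleton ℝ E v) volume μ
      (hA.compl.union hS) fun y ↦ ?_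
    have hg : LipschitzWith K (fun t : ℝ ↦ F (y + t • v)) := by
      refine LipschitzWith.of_dist_le_mul fun s t ↦ (hF.dist_le_mul _ _).trans_eq ?_
      rw [dist_add_left, dist_eq_norm, ← sub_smul, norm_smul, hv, mul_one, dist_eq_norm]
    have hm : Measurable fun t : ℝ ↦ y + t • v := by fun_prop
    have hgA : ∀ t ∈ (fun t : ℝ ↦ y + t • v) ⁻¹' A, ∀ i,
        |deriv (fun s ↦ dist (F (y + s • v)) (p i)) t| ≤ ε := by
      intro t ht i
      convert ht i using 2
      simp only [lineDeriv]
      rw [← zero_add t, ← deriv_comp_add_const]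
      simp [add_smul, add_assoc, add_comm]
    filter_upwards [ae_exists_dist_le_of_abs_deriv_dist_le hg (p := p)
      (fun s t c h ↦ hp _ _ c h) (hm hA) hε hgA] with t ht
    by_cases htA : y + t • v ∈ A
    · obtain ⟨m, hm⟩ := ht htA
      refine Or.inr (mem_iUnion.2 ⟨m, fun h hh ↦ ?_⟩)
      simpa [add_smul, add_assoc] using hm h hh
    · exact Or.inl htA
  filter_upwards [hmem] with x hx hxA
  rcases hx with hx | hx
  · exact absurd hxA hx
  · exact mem_iUnion.1 hx

variable [MetricSpace X] [MeasurableSpace X] [BorelSpace X] [MeasurableSpace E] [BorelSpace E]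
  [FiniteDimensional ℝ E]

theorem hausdorffMeasure_image_le_of_subset_slowSet {F : E → X} {K : ℝ≥0}
    (hF : LipschitzWith K F) {v : E} (hv : ‖v‖ = 1) {η : ℝ} (hη : 0 ≤ η) {m : ℕ} {S : Set E}
    (hS : S ⊆ slowSet F v (K * η) m)
    (hdiam : ∀ x ∈ S, ∀ y ∈ S, dist x y ≤ 1 / ((m : ℝ) + 1)) :
    μH[Module.finrank ℝ E] (F '' S) ≤ (2 * K : ℝ≥0∞) ^ (Module.finrank ℝ E : ℝ) *
      (ENNReal.ofReal η * μH[Module.finrank ℝ E] S) := by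
  set T : E →ₗ[ℝ] E := LinearMap.transvection ((η - 1) • (innerₛₗ ℝ v)) v with hT
  have hdet : LinearMap.det T = η := by
    simp [hT, LinearMap.transvection.det, hv]
  have := hausdorffMeasure_image_le_of_dist_le (F := F) (T := T) (C := 2 * K) (S := S) ?_
    (Nat.cast_nonneg (Module.finrank ℝ E))
  · rwa [Measure.addHaar_image_linearMap, hdet, abs_of_nonneg hη, ENNReal.coe_mul] at this
  intro x hx y hy
  set w := y - x with hw
  set a : ℝ := inner ℝ v w with ha
  have hTw : T w = η • a • v + (w - a • v) := by
    simp only [hT, LinearMap.transvection.apply, LinearMap.smul_apply, innerₛₗ_apply_apply, ← ha]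
    module
  have horth : inner ℝ (a • v) (w - a • v) = 0 := by
    simp [inner_sub_right, inner_smul_left, norm_smul, hv, ← ha, ← sq]
  have hpyth : ‖T w‖ * ‖T w‖ = (η * |a|) * (η * |a|) + ‖w - a • v‖ * ‖w - a • v‖ := by
    rw [hTw, norm_add_sq_eq_norm_sq_add_norm_sq_real (by rw [inner_smul_left, horth, mul_zero])]
    simp [norm_smul, hv, abs_of_nonneg hη]
  have h1 : η * |a| ≤ ‖T w‖ := abs_le_of_sq_le_sq' (by nlinarith [mul_self_nonneg ‖w - a • v‖])
    (norm_nonneg _) |>.2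
  have h2 : ‖w - a • v‖ ≤ ‖T w‖ := abs_le_of_sq_le_sq' (by nlinarith [mul_self_nonneg (η * |a|)])
    (norm_nonneg _) |>.2
  have haw : |a| ≤ 1 / ((m : ℝ) + 1) := by
    refine ((abs_real_inner_le_norm v w).trans ?_).trans (hdiam y hy x hx)
    rw [hv, one_mul, dist_eq_norm]
  have h3 := hS hx a haw
  have h4 := hF.dist_le_mul (x + a • v) y
  have h5 : dist (x + a • v) y = ‖w - a • v‖ := by
    rw [dist_comm, dist_eq_norm, hw]; congr 1; abel
  have h6 : dist (T x) (T y) = ‖T w‖ := by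
    rw [dist_comm, dist_eq_norm, hw, map_sub]
  rw [h6]
  rw [h5] at h4
  have h7 := dist_triangle_left (F x) (F y) (F (x + a • v))
  have h8 := mul_le_mul_of_nonneg_left h1 K.coe_nonneg
  have h9 := mul_le_mul_of_nonneg_left h2 K.coe_nonneg
  push_cast
  linarith

theorem hausdorffMeasure_image_slowSet_inter_le {F : E → X} {K : ℝ≥0}
    (hF : LipschitzWith K F) {v : E} (hv : ‖v‖ = 1) {η : ℝ} (hη : 0 ≤ η) (m : ℕ) {A : Set E}
    (hA : MeasurableSet A) :
    μH[Module.finrank ℝ E] (F '' (slowSet F v (K * η) m ∩ A)) ≤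
      (2 * K : ℝ≥0∞) ^ (Module.finrank ℝ E : ℝ) *
        (ENNReal.ofReal η * μH[Module.finrank ℝ E] A) := by
  have hr : 0 < 1 / ((m : ℝ) + 1) / 2 := by positivity
  set B : ℕ → Set E := fun n ↦ closedBall (TopologicalSpace.denseSeq E n) (1 / ((m : ℝ) + 1) / 2)
  have hBm (n : ℕ) : MeasurableSet (disjointed B n) :=
    MeasurableSet.disjointed (fun n ↦ measurableSet_closedBall) n
  have hBu : ⋃ n, disjointed B n = univ := by
    rw [iUnion_disjointed, eq_univ_iff_forall]
    intro x
    obtain ⟨n, hn⟩ := (TopologicalSpace.denseRange_denseSeq E).exists_dist_lt x hr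
    exact mem_iUnion.2 ⟨n, hn.le⟩
  set S := slowSet F v (K * η) m
  have hcover : F '' (S ∩ A) = ⋃ n, F '' (S ∩ (A ∩ disjointed B n)) := by
    rw [← image_iUnion, ← inter_iUnion, ← inter_iUnion, hBu, inter_univ]
  calc μH[Module.finrank ℝ E] (F '' (S ∩ A))
      ≤ ∑' n, μH[Module.finrank ℝ E] (F '' (S ∩ (A ∩ disjointed B n))) := by
        rw [hcover]; exact measure_iUnion_le _
    _ ≤ ∑' n, (2 * K : ℝ≥0∞) ^ (Module.finrank ℝ E : ℝ) *
          (ENNReal.ofReal η * μH[Module.finrank ℝ E] (A ∩ disjointed B n)) := by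
        refine ENNReal.tsum_le_tsum fun n ↦ ?_
        refine (hausdorffMeasure_image_le_of_subset_slowSet hF hv hη inter_subset_left
          fun x hx y hy ↦ ?_).trans 
          (mul_le_mul' le_rfl (mul_le_mul' le_rfl (measure_mono inter_subset_right)))
        have h1 := disjointed_subset B n hx.2.2
        have h2 := disjointed_subset B n hy.2.2
        have := dist_triangle_right x y (TopologicalSpace.denseSeq E n)
        have h1' := mem_closedBall.1 h1
        have h2' := mem_closedBall.1 h2
        linarith
    _ = _ := by
        rw [ENNReal.tsum_mul_left, ENNReal.tsum_mul_left, ← measure_iUnion, ← inter_iUnion, hBu,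
          inter_univ]
        · exact fun i j hij ↦ (disjoint_disjointed B hij).mono inter_subset_right inter_subset_right
        · exact fun n ↦ hA.inter (hBm n)

theorem hausdorffMeasure_image_eq_zero_of_forall_mem_slowSet {F : E → X} {K : ℝ≥0}
    (hF : LipschitzWith K F) {v : ℕ → E} (hv : ∀ n, ‖v n‖ = 1) {S : Set E}
    (hS : Bornology.IsBounded S)
    (h : ∀ x ∈ S, ∀ η : ℝ, 0 < η → ∃ n m, x ∈ slowSet F (v n) (K * η) m) :
    μH[Module.finrank ℝ E] (F '' S) = 0 := by
  set d := Module.finrank ℝ E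
  set Q := closure S
  have hQ : μH[d] Q ≠ ∞ := hS.isCompact_closure.measure_lt_top.ne
  have hbound (η : ℝ) (hη : 0 < η) :
      μH[d] (F '' S) ≤ (2 * K : ℝ≥0∞) ^ (d : ℝ) * (ENNReal.ofReal η * μH[d] Q) := by
    set A : ℕ → Set E := fun j ↦ slowSet F (v j.unpair.1) (K * η) j.unpair.2
    have hAm (j : ℕ) : MeasurableSet (disjointed A j) :=
      MeasurableSet.disjointed
        (fun j ↦ (isClosed_slowSet hF.continuous _ _ _).measurableSet) j
    have hcover : F '' S ⊆ ⋃ j, F '' (A j ∩ (Q ∩ disjointed A j)) := by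
      rw [← image_iUnion]
      refine image_mono fun x hx ↦ ?_
      obtain ⟨n, m, hnm⟩ := h x hx η hη
      have : x ∈ ⋃ j, disjointed A j := by
        rw [iUnion_disjointed]
        exact mem_iUnion.2 ⟨Nat.pair n m, by simpa [A] using hnm⟩
      obtain ⟨j, hj⟩ := mem_iUnion.1 this
      exact mem_iUnion.2 ⟨j, disjointed_subset A j hj, subset_closure hx, hj⟩
    calc μH[d] (F '' S) ≤ ∑' j, μH[d] (F '' (A j ∩ (Q ∩ disjointed A j))) :=
          (measure_mono hcover).trans (measure_iUnion_le _)
      _ ≤ ∑' j, (2 * K : ℝ≥0∞) ^ (d : ℝ) * (ENNReal.ofReal η * μH[d] (Q ∩ disjointed A j)) :=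
          ENNReal.tsum_le_tsum fun j ↦ hausdorffMeasure_image_slowSet_inter_le hF (hv _) hη.le _
            (isClosed_closure.measurableSet.inter (hAm j))
      _ = (2 * K : ℝ≥0∞) ^ (d : ℝ) * (ENNReal.ofReal η * μH[d] (⋃ j, Q ∩ disjointed A j)) := by
          rw [ENNReal.tsum_mul_left, ENNReal.tsum_mul_left, measure_iUnion]
          · exact fun i j hij ↦
              (disjoint_disjointed A hij).mono inter_subset_right inter_subset_right
          · exact fun j ↦ isClosed_closure.measurableSet.inter (hAm j)
      _ ≤ _ := by
          gcongr
          exact iUnion_subset fun j ↦ inter_subset_left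
  have hlim : Tendsto (fun η : ℝ ↦ (2 * K : ℝ≥0∞) ^ (d : ℝ) * (ENNReal.ofReal η * μH[d] Q))
      (nhdsWithin 0 (Ioi 0)) (nhds 0) := by
    have h0 : Tendsto (fun η : ℝ ↦ ENNReal.ofReal η) (nhdsWithin 0 (Ioi 0)) (nhds 0) := by
      have := (ENNReal.continuous_ofReal.tendsto 0).mono_left (nhdsWithin_le_nhds (s := Ioi 0))
      simpa using this
    have h1 := ENNReal.Tendsto.mul_const h0 (Or.inr hQ)
    rw [zero_mul] at h1
    have h2 := ENNReal.Tendsto.const_mul (a := (2 * K : ℝ≥0∞) ^ (d : ℝ)) h1 (Or.inr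
      (ENNReal.rpow_ne_top_of_nonneg d.cast_nonneg
        (ENNReal.mul_ne_top ENNReal.ofNat_ne_top ENNReal.coe_ne_top)))
    rwa [mul_zero] at h2
  exact le_antisymm (ge_of_tendsto hlim (eventually_mem_nhdsWithin.mono hbound)) bot_le

end SlowSet

theorem BiLipschitzOn.of_le_mul_dist {X Y : Type*} [PseudoMetricSpace X] [PseudoMetricSpace Y]
    {F : X → Y} {K : ℝ≥0} (hF : LipschitzWith K F) {S : Set X} {c : ℝ≥0}
    (h : ∀ x ∈ S, ∀ y ∈ S, dist x y ≤ c * dist (F x) (F y)) : BiLipschitzOn F S := by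
  refine ⟨max 1 (max K c), le_max_left _ _, fun x hx y hy ↦ ⟨?_, ?_⟩⟩
  · rw [inv_mul_le_iff₀ (lt_max_of_lt_left one_pos)]
    refine (h x hx y hy).trans ?_
    gcongr
    exact (le_max_right _ _).trans (le_max_right _ _)
  · refine (hF.dist_le_mul x y).trans ?_
    gcongr
    exact (le_max_left _ _).trans (le_max_right _ _)

theorem BiLipschitzOn.mono {X Y : Type*} [PseudoMetricSpace X] [PseudoMetricSpace Y]
    {F : X → Y} {S T : Set X} (hT : BiLipschitzOn F T) (hST : S ⊆ T) : BiLipschitzOn F S := by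
  obtain ⟨L, hL, h⟩ := hT
  exact ⟨L, hL, fun x hx y hy ↦ h x (hST hx) y (hST hy)⟩

theorem BiLipschitzOn.closure {X Y : Type*} [PseudoMetricSpace X] [PseudoMetricSpace Y]
    {F : X → Y} (hF : Continuous F) {S : Set X} (h : BiLipschitzOn F S) :
    BiLipschitzOn F (closure S) := by
  obtain ⟨L, hL, h⟩ := h
  refine ⟨L, hL, fun x hx y hy ↦ ?_⟩
  have hcl : IsClosed {p : X × X | L⁻¹ * dist p.1 p.2 ≤ dist (F p.1) (F p.2) ∧
      dist (F p.1) (F p.2) ≤ L * dist p.1 p.2} :=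
    IsClosed.and (isClosed_le (by fun_prop) (by fun_prop)) (isClosed_le (by fun_prop) (by fun_prop))
  have hsub : S ×ˢ S ⊆ {p : X × X | L⁻¹ * dist p.1 p.2 ≤ dist (F p.1) (F p.2) ∧
      dist (F p.1) (F p.2) ≤ L * dist p.1 p.2} := fun p hp ↦ h p.1 hp.1 p.2 hp.2
  have := closure_minimal hsub hcl
  rw [closure_prod_eq] at this
  exact this (mk_mem_prod hx hy)

theorem exists_cover_antilipschitz_of_injective_fderiv {E E' : Type*} [NormedAddCommGroup E]
    [NormedSpace ℝ E] [FiniteDimensional ℝ E] [NormedAddCommGroup E'] [NormedSpace ℝ E']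
    [FiniteDimensional ℝ E'] (Φ : E → E') {S : Set E} {Φ' : E → E →L[ℝ] E'}
    (hΦ : ∀ x ∈ S, HasFDerivAt Φ (Φ' x) x) (hinj : ∀ x ∈ S, Function.Injective (Φ' x)) :
    ∃ B : ℕ → Set E, S ⊆ ⋃ n, B n ∧
      ∀ n, ∃ c : ℝ≥0, ∀ x ∈ B n, ∀ y ∈ B n, dist x y ≤ c * dist (Φ x) (Φ y) := by
  borelize E
  have hanti (A : E →L[ℝ] E') :
      ∃ K : ℝ≥0, 0 < K ∧ (Function.Injective A → AntilipschitzWith K A) := by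
    by_cases hA : Function.Injective A
    · obtain ⟨K, hK, h⟩ := A.toLinearMap.exists_antilipschitzWith (LinearMap.ker_eq_bot.2 hA)
      exact ⟨K, hK, fun _ ↦ h⟩
    · exact ⟨1, one_pos, fun h ↦ absurd h hA⟩
  choose K hK hKA using hanti
  obtain ⟨t, A, -, -, hcover, happrox, hAS⟩ :=
    exists_partition_approximatesLinearOn_of_hasFDerivWithinAt Φ S Φ'
      (fun x hx ↦ (hΦ x hx).hasFDerivWithinAt) (fun A ↦ (2 * K A)⁻¹)
      (fun A ↦ (inv_pos.2 (mul_pos two_pos (hK A))).ne')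
  refine ⟨fun n ↦ S ∩ t n, by rw [← inter_iUnion]; exact subset_inter subset_rfl hcover,
    fun n ↦ ⟨2 * K (A n), fun x hx y hy ↦ ?_⟩⟩
  obtain ⟨z, hz, hAz⟩ := hAS ⟨x, hx.1⟩ n
  have hA := hKA (A n) (hAz ▸ hinj z hz)
  have h1 := happrox n x hx y hy
  have h2 := hA.le_mul_dist x y
  have h3 := norm_sub_norm_le (A n (x - y)) (Φ x - Φ y)
  rw [norm_sub_rev (A n (x - y))] at h3
  rw [dist_eq_norm, dist_eq_norm, ← map_sub] at h2
  rw [dist_eq_norm, dist_eq_norm]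
  push_cast
  have hKpos : (0 : ℝ) < K (A n) := hK (A n)
  push_cast at h1
  have h4 : (K (A n) : ℝ) * ‖A n (x - y)‖ ≤
      K (A n) * (‖Φ x - Φ y‖ + (2 * (K (A n) : ℝ))⁻¹ * ‖x - y‖) :=
    mul_le_mul_of_nonneg_left (by linarith) hKpos.le
  have h5 : K (A n) * (‖Φ x - Φ y‖ + (2 * (K (A n) : ℝ))⁻¹ * ‖x - y‖) =
      K (A n) * ‖Φ x - Φ y‖ + ‖x - y‖ / 2 := by field_simp
  linarith

theorem exists_finset_forall_eq_zero {E : Type*} [NormedAddCommGroup E] [NormedSpace ℝ E]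
    [FiniteDimensional ℝ E] {ι : Type*} (l : ι → E →L[ℝ] ℝ)
    (h : ∀ v, ‖v‖ = 1 → ∃ i, l i v ≠ 0) :
    ∃ s : Finset ι, ∀ v, (∀ i ∈ s, l i v = 0) → v = 0 := by
  obtain ⟨s, hs⟩ := (isCompact_sphere (0 : E) 1).elim_finite_subcover (fun i ↦ {v | l i v ≠ 0})
    (fun i ↦ isOpen_ne_fun (l i).continuous continuous_const)
    (fun v hv ↦ mem_iUnion.2 (h v (mem_sphere_zero_iff_norm.1 hv)))
  refine ⟨s, fun v hv ↦ by_contra fun hv0 ↦ ?_⟩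
  have hmem : ‖v‖⁻¹ • v ∈ sphere (0 : E) 1 := by
    rw [mem_sphere_zero_iff_norm, norm_smul, norm_inv, norm_norm,
      inv_mul_cancel₀ (norm_ne_zero_iff.2 hv0)]
  obtain ⟨i, his, hi⟩ := mem_iUnion₂.1 (hs hmem)
  exact hi (by rw [map_smul, hv i his, smul_zero])

theorem exists_biLipschitzOn_cover {X E : Type*} [PseudoMetricSpace X] [NormedAddCommGroup E]
    [NormedSpace ℝ E] [FiniteDimensional ℝ E] {F : E → X} {K : ℝ≥0} (hF : LipschitzWith K F)
    {ι : Type*} [Countable ι] (p : ι → X) :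
    ∃ B : ℕ → Set E, (∀ n, BiLipschitzOn F (B n)) ∧
      ∀ x, (∀ i, DifferentiableAt ℝ (fun y ↦ dist (F y) (p i)) x) →
        (∀ v, ‖v‖ = 1 → ∃ i, fderiv ℝ (fun y ↦ dist (F y) (p i)) x v ≠ 0) → x ∈ ⋃ n, B n := by
  set f : ι → E → ℝ := fun i y ↦ dist (F y) (p i)
  set S : Finset ι → Set E := fun s ↦ {x | (∀ i, DifferentiableAt ℝ (f i) x) ∧
    ∀ v, (∀ i ∈ s, fderiv ℝ (f i) x v = 0) → v = 0}
  have hpiece (s : Finset ι) :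
      ∃ B : ℕ → Set E, S s ⊆ ⋃ n, B n ∧ ∀ n, BiLipschitzOn F (B n) := by
    obtain ⟨B, hB, h⟩ := exists_cover_antilipschitz_of_injective_fderiv
      (fun x (i : s) ↦ f i x) (S := S s)
      (Φ' := fun x ↦ ContinuousLinearMap.pi fun i : s ↦ fderiv ℝ (f i) x)
      (fun x hx ↦ hasFDerivAt_pi.2 fun i ↦ (hx.1 i).hasFDerivAt)
      (fun x hx ↦ (injective_iff_map_eq_zero _).2 fun v hv ↦
        hx.2 v fun i hi ↦ congrFun hv ⟨i, hi⟩)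
    refine ⟨B, hB, fun n ↦ ?_⟩
    obtain ⟨c, hcB⟩ := h n
    refine BiLipschitzOn.of_le_mul_dist hF (c := c) fun x hx y hy ↦ (hcB x hx y hy).trans ?_
    gcongr
    exact (dist_pi_le_iff dist_nonneg).2 fun i ↦ abs_dist_sub_le (F x) (F y) (p i)
  choose B hB hBF using hpiece
  obtain ⟨e, he⟩ := exists_surjective_nat (Finset ι × ℕ)
  refine ⟨fun n ↦ B (e n).1 (e n).2, fun n ↦ hBF _ _, fun x hx hv ↦ ?_⟩
  obtain ⟨s, hs⟩ := exists_finset_forall_eq_zero (fun i ↦ fderiv ℝ (f i) x) hv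
  obtain ⟨n, hn⟩ := mem_iUnion.1 (hB s ⟨hx, hs⟩)
  obtain ⟨j, hj⟩ := he (s, n)
  exact mem_iUnion.2 ⟨j, by simpa [hj] using hn⟩

/-- Kirchheim's decomposition: up to a set whose image is Hausdorff null, a bounded set is a
countable union of sets on which `F` is biLipschitz. -/
theorem exists_biLipschitzOn_hausdorffMeasure_image_diff_eq_zero {X E : Type*} [MetricSpace X]
    [MeasurableSpace X] [BorelSpace X] [NormedAddCommGroup E] [InnerProductSpace ℝ E]
    [FiniteDimensional ℝ E] [Nontrivial E] [MeasurableSpace E] [BorelSpace E] {F : E → X}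
    {K : ℝ≥0} (hF : LipschitzWith K F) {Q : Set E} (hQ : Bornology.IsBounded Q) :
    ∃ B : ℕ → Set E, (∀ n, BiLipschitzOn F (B n)) ∧
      μH[Module.finrank ℝ E] (F '' (Q \ ⋃ n, B n)) = 0 := by
  set d := Module.finrank ℝ E
  set p : ℕ → X := fun i ↦ F (TopologicalSpace.denseSeq E i)
  have hp (x y : E) (c : ℝ) (h : ∀ i, |dist (F x) (p i) - dist (F y) (p i)| ≤ c) :
      dist (F x) (F y) ≤ c := by
    have hcl : IsClosed {z | |dist (F x) (F z) - dist (F y) (F z)| ≤ c} := by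
      have := hF.continuous
      exact isClosed_le (by fun_prop) continuous_const
    have hall : ∀ z, |dist (F x) (F z) - dist (F y) (F z)| ≤ c := fun z ↦
      (TopologicalSpace.denseRange_denseSeq E).induction_on z hcl h
    simpa using hall y
  set f : ℕ → E → ℝ := fun i y ↦ dist (F y) (p i)
  have hfK (i : ℕ) : LipschitzWith K (f i) := by
    simpa [Function.comp_def] using (LipschitzWith.dist_left (p i)).comp hF
  have : Nonempty (sphere (0 : E) 1) := (NormedSpace.sphere_nonempty.2 zero_le_one).to_subtype
  set v : ℕ → E := fun n ↦ TopologicalSpace.denseSeq (sphere (0 : E) 1) n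
  have hv (n : ℕ) : ‖v n‖ = 1 :=
    mem_sphere_zero_iff_norm.1 (TopologicalSpace.denseSeq (sphere (0 : E) 1) n).2
  obtain ⟨B, hBF, hB⟩ := exists_biLipschitzOn_cover hF p
  set K' : ℝ≥0 := K + 1
  have hF' : LipschitzWith K' F := hF.weaken (by simp [K'])
  have hK' : (0 : ℝ) < K' := by positivity
  have hslow : ∀ᵐ x ∂(μH[d] : Measure E), ∀ n j : ℕ,
      (∀ i, |lineDeriv ℝ (f i) x (v n)| ≤ K' * (1 / ((j : ℝ) + 1)) / 2) →
        ∃ m, x ∈ slowSet F (v n) (2 * (K' * (1 / ((j : ℝ) + 1)) / 2)) m :=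
    ae_all_iff.2 fun n ↦ ae_all_iff.2 fun j ↦
      ae_exists_mem_slowSet _ hF hp (hv n) (by positivity)
  have hdiff : ∀ᵐ x ∂(μH[d] : Measure E), ∀ i, DifferentiableAt ℝ (f i) x :=
    ae_all_iff.2 fun i ↦ (hfK i).ae_differentiableAt
  have hgood := hslow.and hdiff
  set G : Set E := {x | (∀ n j : ℕ,
      (∀ i, |lineDeriv ℝ (f i) x (v n)| ≤ K' * (1 / ((j : ℝ) + 1)) / 2) →
        ∃ m, x ∈ slowSet F (v n) (2 * (K' * (1 / ((j : ℝ) + 1)) / 2)) m) ∧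
      ∀ i, DifferentiableAt ℝ (f i) x}
  have hGnull : μH[d] Gᶜ = 0 := hgood
  have hnull : μH[d] (F '' Gᶜ) = 0 := by
    refine le_antisymm ((hF.hausdorffMeasure_image_le d.cast_nonneg _).trans ?_) bot_le
    rw [hGnull, mul_zero]
  have hdeg : μH[d] (F '' ((Q \ ⋃ n, B n) ∩ G)) = 0 := by
    refine hausdorffMeasure_image_eq_zero_of_forall_mem_slowSet hF' hv
      (hQ.subset (inter_subset_left.trans sdiff_subset)) fun x hx η hη ↦ ?_
    obtain ⟨⟨-, hxB⟩, hxslow, hxdiff⟩ := hx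
    obtain ⟨w, hw, hfw⟩ : ∃ w, ‖w‖ = 1 ∧ ∀ i, fderiv ℝ (f i) x w = 0 := by
      by_contra! hcon
      exact hxB (hB x hxdiff hcon)
    obtain ⟨j, hj⟩ := exists_nat_one_div_lt hη
    obtain ⟨n, hn⟩ := (TopologicalSpace.denseRange_denseSeq (sphere (0 : E) 1)).exists_dist_lt
      ⟨w, mem_sphere_zero_iff_norm.2 hw⟩ (show 0 < 1 / ((j : ℝ) + 1) / 2 by positivity)
    have hn' : ‖v n - w‖ < 1 / ((j : ℝ) + 1) / 2 := by
      rwa [Subtype.dist_eq, dist_comm, dist_eq_norm] at hn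
    obtain ⟨m, hm⟩ := hxslow n j fun i ↦ by
      rw [(hxdiff i).lineDeriv_eq_fderiv]
      have h1 : fderiv ℝ (f i) x (v n) = fderiv ℝ (f i) x (v n - w) := by
        rw [map_sub, hfw i, sub_zero]
      rw [h1, ← Real.norm_eq_abs]
      calc ‖fderiv ℝ (f i) x (v n - w)‖ ≤ ‖fderiv ℝ (f i) x‖ * ‖v n - w‖ :=
            ContinuousLinearMap.le_opNorm _ _
        _ ≤ K' * (1 / ((j : ℝ) + 1) / 2) := by
            gcongr
            exact (norm_fderiv_le_of_lipschitz ℝ (hfK i)).trans (by simp [K'])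
        _ = _ := by ring
    refine ⟨n, m, fun t ht ↦ (hm t ht).trans ?_⟩
    refine mul_le_mul_of_nonneg_right ?_ (abs_nonneg t)
    calc 2 * (K' * (1 / ((j : ℝ) + 1)) / 2) = K' * (1 / ((j : ℝ) + 1)) := by ring
      _ ≤ K' * η := by gcongr
  refine ⟨B, hBF, measure_mono_null (image_mono ?_)
    ((image_union F _ _).symm ▸ measure_union_null hdeg hnull)⟩
  intro x hx
  by_cases hxG : x ∈ G
  · exact Or.inl ⟨hx, hxG⟩
  · exact Or.inr hxG

/-- The coordinatewise projection of `ℝ^k` onto the unit cube. -/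
def cubeProj (k : ℕ) (x : EuclideanSpace ℝ (Fin k)) : EuclideanSpace ℝ (Fin k) :=
  WithLp.toLp 2 fun i ↦ projIcc (0 : ℝ) 1 zero_le_one (x i)

theorem cubeProj_mem (k : ℕ) (x : EuclideanSpace ℝ (Fin k)) : cubeProj k x ∈ unitCube k :=
  fun i ↦ (projIcc (0 : ℝ) 1 zero_le_one (x i)).2

theorem cubeProj_of_mem {k : ℕ} {x : EuclideanSpace ℝ (Fin k)} (hx : x ∈ unitCube k) :
    cubeProj k x = x := by
  ext i
  simp [cubeProj, projIcc_of_mem _ (hx i)]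

theorem lipschitzWith_cubeProj (k : ℕ) : LipschitzWith 1 (cubeProj k) := by
  refine LipschitzWith.of_dist_le_mul fun x y ↦ ?_
  rw [NNReal.coe_one, one_mul, EuclideanSpace.dist_eq, EuclideanSpace.dist_eq]
  gcongr with i
  simpa [cubeProj, Subtype.dist_eq] using
    (LipschitzWith.projIcc (zero_le_one' ℝ)).dist_le_mul (x i) (y i)

theorem isCompact_unitCube (k : ℕ) : IsCompact (unitCube k) := by
  have : unitCube k =
      (EuclideanSpace.equiv (Fin k) ℝ).toHomeomorph ⁻¹' univ.pi fun _ ↦ Icc (0 : ℝ) 1 := by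
    ext x
    simp [unitCube, Pi.le_def, forall_and]
  rw [this, Homeomorph.isCompact_preimage]
  exact isCompact_univ_pi fun _ ↦ isCompact_Icc

theorem exists_hausdorffMeasure_image_diff_biUnion_lt {X E : Type*} [MetricSpace X]
    [MeasurableSpace X] [BorelSpace X] [MetricSpace E] [MeasurableSpace E]
    [BorelSpace E] {F : E → X} {K : ℝ≥0} (hF : LipschitzWith K F) {d : ℝ} (hd : 0 ≤ d)
    {Q : Set E} (hQ : MeasurableSet Q) (hQfin : μH[d] Q ≠ ∞) {B : ℕ → Set E}
    (hB : ∀ n, MeasurableSet (B n)) (hnull : μH[d] (F '' (Q \ ⋃ n, B n)) = 0)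
    {δ : ℝ≥0∞} (hδ : 0 < δ) : ∃ n : ℕ, μH[d] (F '' (Q \ ⋃ j : Fin n, B j)) < δ := by
  set U : Set E := ⋃ n, B n
  set V : ℕ → Set E := fun n ↦ ⋃ j : Fin n, B j
  have hV (n : ℕ) : MeasurableSet (V n) := MeasurableSet.iUnion fun j ↦ hB j
  have hanti : Antitone fun n ↦ (Q ∩ U) \ V n := fun a b hab ↦ sdiff_subset_sdiff_right
    (iUnion_subset fun j ↦ subset_iUnion_of_subset (Fin.castLE hab j) subset_rfl)
  have hempty : ⋂ n, (Q ∩ U) \ V n = ∅ := by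
    refine eq_empty_of_forall_notMem fun x hx ↦ ?_
    rw [mem_iInter] at hx
    obtain ⟨n, hn⟩ := mem_iUnion.1 (hx 0).1.2
    exact (hx (n + 1)).2 (mem_iUnion.2 ⟨Fin.last n, hn⟩)
  have hlim : Tendsto (fun n ↦ (K : ℝ≥0∞) ^ d * μH[d] ((Q ∩ U) \ V n)) atTop (nhds 0) := by
    have := tendsto_measure_iInter_atTop (μ := (μH[d] : Measure E))
      (fun n ↦ ((hQ.inter (MeasurableSet.iUnion hB)).diff (hV n)).nullMeasurableSet) hanti
      ⟨0, ne_top_of_le_ne_top hQfin (measure_mono (sdiff_subset.trans inter_subset_left))⟩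
    rw [hempty, measure_empty] at this
    simpa using ENNReal.Tendsto.const_mul (a := (K : ℝ≥0∞) ^ d) this
      (Or.inr (ENNReal.rpow_ne_top_of_nonneg hd ENNReal.coe_ne_top))
  obtain ⟨n, hn⟩ := (hlim.eventually_lt_const hδ).exists
  refine ⟨n, lt_of_le_of_lt ?_ hn⟩
  have hsub : Q \ V n ⊆ (Q \ U) ∪ ((Q ∩ U) \ V n) := fun x hx ↦ by
    by_cases hxU : x ∈ U
    · exact Or.inr ⟨⟨hx.1, hxU⟩, hx.2⟩
    · exact Or.inl ⟨hx.1, hxU⟩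
  calc μH[d] (F '' (Q \ V n)) ≤ μH[d] (F '' (Q \ U)) + μH[d] (F '' ((Q ∩ U) \ V n)) := by
        refine (measure_mono (image_mono hsub)).trans ?_
        rw [image_union]
        exact measure_union_le _ _
    _ ≤ _ := by
        rw [hnull, zero_add]
        exact hF.hausdorffMeasure_image_le hd _

/-- Schul. If `F : [0,1]^k → X` is Lipschitz into a metric space and
`δ > 0`, then `[0,1]^k = G ∪ F_1 ∪ ⋯ ∪ F_n` where `h^k(F(G)) < δ` and `F` is biLipschitz
on each `F_j`. -/
theorem statement2 (k : ℕ) (hk : 0 < k) {X : Type*} [MetricSpace X]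
    (F : EuclideanSpace ℝ (Fin k) → X) (L : ℝ≥0)
    (hF : LipschitzOnWith L F (unitCube k)) (δ : ℝ) (hδ : 0 < δ) :
    ∃ (n : ℕ) (G : Set (EuclideanSpace ℝ (Fin k)))
      (Fs : Fin n → Set (EuclideanSpace ℝ (Fin k))), 0 < n ∧
      G ⊆ unitCube k ∧ (∀ j, Fs j ⊆ unitCube k) ∧
      unitCube k = G ∪ ⋃ j, Fs j ∧
      hContent k (F '' G) < ENNReal.ofReal δ ∧
      ∀ j, BiLipschitzOn F (Fs j) := by
  borelize X
  set Q := unitCube k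
  have hQ : IsCompact Q := isCompact_unitCube k
  set H : EuclideanSpace ℝ (Fin k) → X := F ∘ cubeProj k
  have hH : LipschitzWith L H := by
    have := hF.comp ((lipschitzWith_cubeProj k).lipschitzOnWith (s := univ))
      fun x _ ↦ cubeProj_mem k x
    rwa [mul_one, lipschitzOnWith_univ] at this
  have hHF : EqOn H F Q := fun x hx ↦ congrArg F (cubeProj_of_mem hx)
  have : Nonempty (Fin k) := ⟨⟨0, hk⟩⟩
  have hfin : Module.finrank ℝ (EuclideanSpace ℝ (Fin k)) = k := by simp
  have hQfin : μH[(k : ℝ)] Q ≠ ∞ := by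
    have := hQ.measure_lt_top (μ := μH[Module.finrank ℝ (EuclideanSpace ℝ (Fin k))])
    rw [hfin] at this
    exact this.ne
  obtain ⟨B, hB, hnull⟩ :=
    exists_biLipschitzOn_hausdorffMeasure_image_diff_eq_zero hH hQ.isBounded
  rw [hfin] at hnull
  obtain ⟨n, hn⟩ := exists_hausdorffMeasure_image_diff_biUnion_lt hH (Nat.cast_nonneg k)
    hQ.measurableSet hQfin (B := fun n ↦ closure (B n)) (fun n ↦ measurableSet_closure)
    (measure_mono_null (image_mono (sdiff_subset_sdiff_right
      (iUnion_mono fun n ↦ subset_closure))) hnull) (ENNReal.ofReal_pos.2 hδ)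
  refine ⟨n + 1, Q \ ⋃ j : Fin n, closure (B j), fun j ↦ Q ∩ closure (B j), n.succ_pos,
    sdiff_subset, fun j ↦ inter_subset_left, ?_, ?_, fun j ↦ ?_⟩
  · refine Subset.antisymm (fun x hx ↦ ?_)
      (union_subset sdiff_subset (iUnion_subset fun j ↦ inter_subset_left))
    by_cases h : x ∈ ⋃ j : Fin n, closure (B j)
    · obtain ⟨j, hj⟩ := mem_iUnion.1 h
      exact Or.inr (mem_iUnion.2 ⟨j.castSucc, hx, hj⟩)
    · exact Or.inl ⟨hx, h⟩
  · rw [← (hHF.mono sdiff_subset).image_eq]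
    exact (hContent_le_hausdorffMeasure (Nat.cast_pos.2 hk) _).trans_lt hn
  · obtain ⟨C, hC, h⟩ := ((hB j).closure hH.continuous).mono (inter_subset_right (s := Q))
    refine ⟨C, hC, fun x hx y hy ↦ ?_⟩
    rw [← hHF hx.1, ← hHF hy.1]
    exact h x hx y hy
end
end
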